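/- Let q(·) ∈ LH ∩ 𝒫 and v ∈ A_{q(·)}, and let b ∈ BMO. For any l ∈ (1,∞), if t/r ≥ l, then for every x₀ ∈ ℝⁿ, ‖b − b_{B(x₀,r)}‖_{L^{q(·)}(B(x₀,t), v dx)} ≲ (1 + log(t/r)) ‖b‖_{BMO} ‖v‖_{L^{q(·)}(B(x₀,t))}, where b_{B} = |B|^{-1}∫_B b and the implicit constant depends only on n, l and q(·), v. -/

import Mathlib

open MeasureTheory Metric Set Filter Function
open scoped ENNReal NNReal BigOperators Topology FourierTransform

noncomputable section

/-- Euclidean space `ℝⁿ`. -/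
abbrev Rn (n : ℕ) : Type := EuclideanSpace ℝ (Fin n)

namespace GWM

variable {n m : ℕ}

/-- The weighted measure `ω(E) = ∫_E ω(x) dx`. -/
def wMeas (ω : Rn n → ℝ) (E : Set (Rn n)) : ℝ≥0∞ :=
  ∫⁻ x in E, ENNReal.ofReal (ω x)

/-- `(∫_E g(x)^p ω(x) dx)^(1/p)` for an `ℝ≥0∞`-valued `g`. -/
def wLpNormE (p : ℝ) (ω : Rn n → ℝ) (E : Set (Rn n)) (g : Rn n → ℝ≥0∞) : ℝ≥0∞ :=
  (∫⁻ x in E, g x ^ p * ENNReal.ofReal (ω x)) ^ (1 / p)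

/-- The weighted Lebesgue norm `‖f‖_{L^p(E, ω dx)}`. -/
def wLpNorm (p : ℝ) (ω : Rn n → ℝ) (E : Set (Rn n)) (f : Rn n → ℝ) : ℝ≥0∞ :=
  wLpNormE p ω E fun x => ENNReal.ofReal |f x|

/-- The weak weighted Lebesgue norm, `ℝ≥0∞`-valued version. -/
def wWeakLpNormE (p : ℝ) (ω : Rn n → ℝ) (E : Set (Rn n)) (g : Rn n → ℝ≥0∞) : ℝ≥0∞ :=
  ⨆ (α : ℝ) (_ : 0 < α), ENNReal.ofReal α * wMeas ω {x ∈ E | ENNReal.ofReal α < g x} ^ (1 / p)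

/-- The weak weighted Lebesgue norm `‖f‖_{WL^p(E, ω dx)}`. -/
def wWeakLpNorm (p : ℝ) (ω : Rn n → ℝ) (E : Set (Rn n)) (f : Rn n → ℝ) : ℝ≥0∞ :=
  wWeakLpNormE p ω E fun x => ENNReal.ofReal |f x|

/-- The generalized weighted Morrey norm (`ℝ≥0∞`-valued function version). -/
def morreyNormE (p : ℝ) (φ : Rn n → ℝ → ℝ) (ω : Rn n → ℝ) (g : Rn n → ℝ≥0∞) : ℝ≥0∞ :=
  ⨆ (x : Rn n) (r : ℝ) (_ : 0 < r),
    (ENNReal.ofReal (φ x r))⁻¹ * wMeas ω (ball x r) ^ (-(1 / p)) * wLpNormE p ω (ball x r) g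

/-- The generalized weighted Morrey norm `‖f‖_{M^{p,φ}(ω)}`. -/
def morreyNorm (p : ℝ) (φ : Rn n → ℝ → ℝ) (ω : Rn n → ℝ) (f : Rn n → ℝ) : ℝ≥0∞ :=
  morreyNormE p φ ω fun x => ENNReal.ofReal |f x|

/-- The weak generalized weighted Morrey norm (`ℝ≥0∞`-valued version). -/
def weakMorreyNormE (p : ℝ) (φ : Rn n → ℝ → ℝ) (ω : Rn n → ℝ) (g : Rn n → ℝ≥0∞) : ℝ≥0∞ :=
  ⨆ (x : Rn n) (r : ℝ) (_ : 0 < r),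
    (ENNReal.ofReal (φ x r))⁻¹ * wMeas ω (ball x r) ^ (-(1 / p)) * wWeakLpNormE p ω (ball x r) g

/-- The weak generalized weighted Morrey norm `‖f‖_{WM^{p,φ}(ω)}`. -/
def weakMorreyNorm (p : ℝ) (φ : Rn n → ℝ → ℝ) (ω : Rn n → ℝ) (f : Rn n → ℝ) : ℝ≥0∞ :=
  weakMorreyNormE p φ ω fun x => ENNReal.ofReal |f x|

/-- The generalized local weighted Morrey norm at `x₀` (`ℝ≥0∞`-valued version). -/
def localMorreyNormE (x₀ : Rn n) (p : ℝ) (φ : Rn n → ℝ → ℝ) (ω : Rn n → ℝ)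
    (g : Rn n → ℝ≥0∞) : ℝ≥0∞ :=
  ⨆ (r : ℝ) (_ : 0 < r),
    (ENNReal.ofReal (φ x₀ r))⁻¹ * wMeas ω (ball x₀ r) ^ (-(1 / p)) * wLpNormE p ω (ball x₀ r) g

/-- The generalized local weighted Morrey norm `‖f‖_{M_{x₀}^{p,φ}(ω)}`. -/
def localMorreyNorm (x₀ : Rn n) (p : ℝ) (φ : Rn n → ℝ → ℝ) (ω : Rn n → ℝ)
    (f : Rn n → ℝ) : ℝ≥0∞ :=
  localMorreyNormE x₀ p φ ω fun x => ENNReal.ofReal |f x|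

/-- The weak generalized local weighted Morrey norm (`ℝ≥0∞`-valued version). -/
def localWeakMorreyNormE (x₀ : Rn n) (p : ℝ) (φ : Rn n → ℝ → ℝ) (ω : Rn n → ℝ)
    (g : Rn n → ℝ≥0∞) : ℝ≥0∞ :=
  ⨆ (r : ℝ) (_ : 0 < r),
    (ENNReal.ofReal (φ x₀ r))⁻¹ * wMeas ω (ball x₀ r) ^ (-(1 / p)) *
      wWeakLpNormE p ω (ball x₀ r) g

/-- The weak generalized local weighted Morrey norm `‖f‖_{WM_{x₀}^{p,φ}(ω)}`. -/
def localWeakMorreyNorm (x₀ : Rn n) (p : ℝ) (φ : Rn n → ℝ → ℝ) (ω : Rn n → ℝ)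
    (f : Rn n → ℝ) : ℝ≥0∞ :=
  localWeakMorreyNormE x₀ p φ ω fun x => ENNReal.ofReal |f x|

/-- Membership in the generalized weighted Morrey space `M^{p,φ}(ω)`. -/
def MemMorrey (p : ℝ) (φ : Rn n → ℝ → ℝ) (ω : Rn n → ℝ) (f : Rn n → ℝ) : Prop :=
  LocallyIntegrable f volume ∧ morreyNorm p φ ω f < ⊤

/-- Membership in the generalized local weighted Morrey space `M_{x₀}^{p,φ}(ω)`. -/
def MemLocalMorrey (x₀ : Rn n) (p : ℝ) (φ : Rn n → ℝ → ℝ) (ω : Rn n → ℝ)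
    (f : Rn n → ℝ) : Prop :=
  LocallyIntegrable f volume ∧ localMorreyNorm x₀ p φ ω f < ⊤

/-- A weight: a nonnegative locally integrable function, positive a.e. -/
def IsWeight (ω : Rn n → ℝ) : Prop :=
  LocallyIntegrable ω volume ∧ (∀ x, 0 ≤ ω x) ∧
    ∀ᵐ x ∂(volume : Measure (Rn n)), 0 < ω x

/-- The Muckenhoupt class `A₁`. -/
def IsA1 (ω : Rn n → ℝ) : Prop :=
  ∃ C : ℝ≥0, ∀ (x : Rn n) (r : ℝ), 0 < r →
    wMeas ω (ball x r) ≤ C * volume (ball x r) *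
      essInf (fun y => ENNReal.ofReal (ω y)) (volume.restrict (ball x r))

/-- The Muckenhoupt class `A_q`, `1 < q < ∞`. -/
def IsAq (q : ℝ) (ω : Rn n → ℝ) : Prop :=
  ∃ C : ℝ≥0, ∀ (x : Rn n) (r : ℝ), 0 < r →
    (volume (ball x r))⁻¹ * wMeas ω (ball x r) *
      ((volume (ball x r))⁻¹ *
        ∫⁻ y in ball x r, ENNReal.ofReal (ω y) ^ (-(1 / (q - 1)))) ^ (q - 1) ≤ C

/-- The Muckenhoupt class `A_∞ = ⋃_{1 ≤ q < ∞} A_q`. -/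
def IsAinf (ω : Rn n → ℝ) : Prop := IsA1 ω ∨ ∃ q : ℝ, 1 < q ∧ IsAq q ω

/-- The multiple weight `ν_{ω⃗} = ∏ ωᵢ^{p/pᵢ}`. -/
def nuw (p : ℝ) (ps : Fin m → ℝ) (ωs : Fin m → Rn n → ℝ) : Rn n → ℝ :=
  fun x => ∏ i, ωs i x ^ (p / ps i)

/-- The factor `(|B|⁻¹ ∫_B ωᵢ^{1-pᵢ'})^{1/pᵢ'}` in the `A_{P⃗}` condition, with the usual
modification `(essinf_B ωᵢ)⁻¹` when `pᵢ = 1`. -/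
def APfactor (q : ℝ) (ω : Rn n → ℝ) (E : Set (Rn n)) : ℝ≥0∞ :=
  if q = 1 then (essInf (fun y => ENNReal.ofReal (ω y)) (volume.restrict E))⁻¹
  else ((volume E)⁻¹ * ∫⁻ y in E, ENNReal.ofReal (ω y) ^ (-(1 / (q - 1)))) ^ ((q - 1) / q)

/-- The multiple Muckenhoupt condition `ω⃗ ∈ A_{P⃗}`. -/
def IsMultiAP (p : ℝ) (ps : Fin m → ℝ) (ωs : Fin m → Rn n → ℝ) : Prop :=
  ∃ C : ℝ≥0, ∀ (x : Rn n) (r : ℝ), 0 < r →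
    ((volume (ball x r))⁻¹ * wMeas (nuw p ps ωs) (ball x r)) ^ (1 / p) *
      ∏ i, APfactor (ps i) (ωs i) (ball x r) ≤ C

/-- The average `b_E = |E|⁻¹ ∫_E b`. -/
def ballAvg (b : Rn n → ℝ) (E : Set (Rn n)) : ℝ := (∫ y in E, b y) / (volume E).toReal

/-- The BMO norm `‖b‖_{BMO} = sup_B |B|⁻¹ ∫_B |b - b_B|`. -/
def bmoNorm (b : Rn n → ℝ) : ℝ≥0∞ :=
  ⨆ (x : Rn n) (r : ℝ) (_ : 0 < r),
    (volume (ball x r))⁻¹ * ∫⁻ y in ball x r, ENNReal.ofReal |b y - ballAvg b (ball x r)|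

/-- `b ∈ BMO`. -/
def MemBMO (b : Rn n → ℝ) : Prop := LocallyIntegrable b volume ∧ bmoNorm b < ⊤

/-- `f⁰ = f·χ_{2B}` for the ball `B = B(x₀,r)`. -/
def loc0 (x₀ : Rn n) (r : ℝ) (f : Rn n → ℝ) : Rn n → ℝ := (ball x₀ (2 * r)).indicator f

/-- `f^∞ = f·χ_{(2B)ᶜ}` for the ball `B = B(x₀,r)`. -/
def locInf (x₀ : Rn n) (r : ℝ) (f : Rn n → ℝ) : Rn n → ℝ := (ball x₀ (2 * r))ᶜ.indicator f

/-- `Σ_{j=1}^∞ ∏_{i=1}^m |2^{j+1}B|⁻¹ ∫_{2^{j+1}B} |fᵢ|`, for `B = B(x₀,r)`. -/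
def lsSum (x₀ : Rn n) (r : ℝ) (f : Fin m → Rn n → ℝ) : ℝ≥0∞ :=
  ∑' j : ℕ, ∏ i, (volume (ball x₀ (2 ^ (j + 2) * r)))⁻¹ *
    ∫⁻ y in ball x₀ (2 ^ (j + 2) * r), ENNReal.ofReal |f i y|

/-- The local size condition `T ∈ LS(∏ Xᵢ)`. -/
def LS (T : (Fin m → Rn n → ℝ) → Rn n → ℝ) (X : Fin m → (Rn n → ℝ) → Prop) : Prop :=
  ∃ C : ℝ≥0, ∀ (x₀ : Rn n) (r : ℝ), 0 < r → ∀ f : Fin m → Rn n → ℝ, (∀ i, X i (f i)) →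
    ∀ ℓ : ℕ, 1 ≤ ℓ → ℓ ≤ m →
      essSup
        (fun x => ENNReal.ofReal
          |T (fun i => if (i : ℕ) < ℓ then locInf x₀ r (f i) else loc0 x₀ r (f i)) x|)
        (volume.restrict (ball x₀ r)) ≤ C * lsSum x₀ r f

/-- The local boundedness condition `T ∈ LB(∏ Xᵢ → Y)`. -/
def LB (T : (Fin m → Rn n → ℝ) → Rn n → ℝ) (X : Fin m → (Rn n → ℝ) → Prop)
    (Xnorm : Fin m → (Rn n → ℝ) → ℝ≥0∞) (Ynorm : (Rn n → ℝ) → ℝ≥0∞) : Prop :=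
  ∃ C : ℝ≥0, ∀ (x₀ : Rn n) (r : ℝ), 0 < r → ∀ f : Fin m → Rn n → ℝ, (∀ i, X i (f i)) →
    Ynorm (T fun i => loc0 x₀ r (f i)) ≤ C * ∏ i, Xnorm i (f i)

/-- `T` is `m`-sublinear (subadditive in each entry). -/
def MSublinear (T : (Fin m → Rn n → ℝ) → Rn n → ℝ) : Prop :=
  ∀ (f : Fin m → Rn n → ℝ) (i : Fin m) (g h : Rn n → ℝ) (x : Rn n),
    |T (Function.update f i (g + h)) x| ≤
      |T (Function.update f i g) x| + |T (Function.update f i h) x|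

/-- Pointwise size condition `|T(f⃗)(x)| ≲ ∫ ∏|fᵢ(yᵢ)| (Σ|x-yⱼ|)^{-mn} dy⃗`
for `x ∉ ⋂ supp fⱼ`. -/
def PointwiseSize (T : (Fin m → Rn n → ℝ) → Rn n → ℝ)
    (X : Fin m → (Rn n → ℝ) → Prop) : Prop :=
  ∃ C : ℝ≥0, ∀ f : Fin m → Rn n → ℝ, (∀ i, X i (f i)) →
    ∀ x : Rn n, x ∉ ⋂ j, Function.support (f j) →
      ENNReal.ofReal |T f x| ≤
        C * ∫⁻ y : Fin m → Rn n,
          (∏ i, ENNReal.ofReal |f i (y i)|) *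
            ENNReal.ofReal (∑ j, dist x (y j)) ^ (-(m * n : ℝ))

/-- The iterated commutator `T_{Π b⃗}`. -/
def iterComm (T : (Fin m → Rn n → ℝ) → Rn n → ℝ) (b f : Fin m → Rn n → ℝ) : Rn n → ℝ :=
  fun x => T (fun i y => (b i x - b i y) * f i y) x

/-- The multilinear commutator `T_{Σ b⃗}`. -/
def sumComm (T : (Fin m → Rn n → ℝ) → Rn n → ℝ) (b f : Fin m → Rn n → ℝ) : Rn n → ℝ :=
  fun x => ∑ j, T (Function.update f j fun y => (b j x - b j y) * f j y) x

/-- `essinf_{t<η<∞} ∏ᵢ φ₁ᵢ(x,η) ωᵢ(B(x,η))^{1/pᵢ}`. -/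
def essInfProd (ps : Fin m → ℝ) (φ1 : Fin m → Rn n → ℝ → ℝ) (ωs : Fin m → Rn n → ℝ)
    (x : Rn n) (t : ℝ) : ℝ≥0∞ :=
  essInf (fun η => ∏ i, ENNReal.ofReal (φ1 i x η) * wMeas (ωs i) (ball x η) ^ (1 / ps i))
    (volume.restrict (Ioi t))

/-- The quantity inside the supremum in the conditions `[φ⃗₁,φ₂]` (with logarithmic factor
`(1+log(t/r))^k`). -/
def phiCondAt (k : ℕ) (ps : Fin m → ℝ) (φ1 : Fin m → Rn n → ℝ → ℝ)
    (ωs : Fin m → Rn n → ℝ) (φ2 : Rn n → ℝ → ℝ) (x : Rn n) (r : ℝ) : ℝ≥0∞ :=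
  (ENNReal.ofReal (φ2 x r))⁻¹ *
    ∫⁻ t in Ioi r,
      ENNReal.ofReal (1 + Real.log (t / r)) ^ k * essInfProd ps φ1 ωs x t *
        (∏ i, wMeas (ωs i) (ball x t) ^ (1 / ps i))⁻¹ * (ENNReal.ofReal t)⁻¹

/-- The condition `[φ⃗₁,φ₂] < ∞` (`k = 0`: condition `[·]₁`; `k = m`: condition `[·]₂`;
`k = 1`: condition `[·]₃`). -/
def phiCond (k : ℕ) (ps : Fin m → ℝ) (φ1 : Fin m → Rn n → ℝ → ℝ)
    (ωs : Fin m → Rn n → ℝ) (φ2 : Rn n → ℝ → ℝ) : Prop :=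
  (⨆ (x : Rn n) (r : ℝ) (_ : 0 < r), phiCondAt k ps φ1 ωs φ2 x r) < ⊤

/-- The local (at `x₀`) condition `[φ⃗₁,φ₂]' < ∞`. -/
def phiCondLoc (x₀ : Rn n) (k : ℕ) (ps : Fin m → ℝ) (φ1 : Fin m → Rn n → ℝ → ℝ)
    (ωs : Fin m → Rn n → ℝ) (φ2 : Rn n → ℝ → ℝ) : Prop :=
  (⨆ (r : ℝ) (_ : 0 < r), phiCondAt k ps φ1 ωs φ2 x₀ r) < ⊤



/-! ### Variable exponent spaces -/

/-- The Luxemburg norm `‖f‖_{L^{p(·)}}`. -/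
def luxNorm (p : Rn n → ℝ) (f : Rn n → ℝ) : ℝ≥0∞ :=
  ⨅ (lam : ℝ≥0∞) (_ : lam ≠ 0)
    (_ : (∫⁻ x, (ENNReal.ofReal |f x| / lam) ^ p x) ≤ 1), lam

/-- `‖f‖_{L^{p(·)}(E)} = ‖f χ_E‖_{L^{p(·)}}`. -/
def luxNormOn (p : Rn n → ℝ) (E : Set (Rn n)) (f : Rn n → ℝ) : ℝ≥0∞ :=
  luxNorm p (E.indicator f)

/-- `p(·) ∈ 𝒫`: measurable with `1 < p⁻ ≤ p⁺ < ∞`. -/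
def MemP (p : Rn n → ℝ) : Prop :=
  Measurable p ∧ ∃ a b : ℝ, 1 < a ∧ ∀ x, a ≤ p x ∧ p x ≤ b

/-- `p(·) ∈ LH`: global log-Hölder continuity. -/
def LogHolder (p : Rn n → ℝ) : Prop :=
  (∃ C : ℝ, ∀ x y : Rn n, 0 < dist x y → dist x y ≤ 1 / 2 →
    |p x - p y| ≤ C / (-Real.log (dist x y))) ∧
  (∃ C : ℝ, ∀ x y : Rn n, ‖x‖ ≤ ‖y‖ →
    |p x - p y| ≤ C / Real.log (Real.exp 1 + ‖x‖))

/-- The conjugate exponent function `p'(·) = p(·)/(p(·)-1)`. -/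
def conjExp (p : Rn n → ℝ) : Rn n → ℝ := fun x => p x / (p x - 1)

/-- The variable exponent Muckenhoupt class `A_{p(·)}`. -/
def IsAvar (p : Rn n → ℝ) (ω : Rn n → ℝ) : Prop :=
  ∃ C : ℝ≥0, ∀ (x : Rn n) (r : ℝ), 0 < r →
    (volume (ball x r))⁻¹ * luxNormOn p (ball x r) ω *
      luxNormOn (conjExp p) (ball x r) (fun y => (ω y)⁻¹) ≤ C

/-- The generalized weighted variable exponent Morrey norm `‖f‖_{M^{p(·),φ}(ω)}`. -/
def varMorreyNorm (p : Rn n → ℝ) (φ : Rn n → ℝ → ℝ) (ω f : Rn n → ℝ) : ℝ≥0∞ :=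
  ⨆ (x : Rn n) (r : ℝ) (_ : 0 < r),
    (ENNReal.ofReal (φ x r))⁻¹ * (luxNormOn p (ball x r) ω)⁻¹ *
      luxNormOn p (ball x r) (fun y => ω y * f y)

/-- Membership in `M^{p(·),φ}(ω)`. -/
def MemVarMorrey (p : Rn n → ℝ) (φ : Rn n → ℝ → ℝ) (ω f : Rn n → ℝ) : Prop :=
  LocallyIntegrable f volume ∧ varMorreyNorm p φ ω f < ⊤

/-- `essinf_{t<η<∞} ∏ᵢ φ₁ᵢ(x,η) ‖ωᵢ‖_{L^{pᵢ(·)}(B(x,η))}`. -/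
def varEssInfProd (ps : Fin m → Rn n → ℝ) (φ1 : Fin m → Rn n → ℝ → ℝ)
    (ωs : Fin m → Rn n → ℝ) (x : Rn n) (t : ℝ) : ℝ≥0∞ :=
  essInf (fun η => ∏ i, ENNReal.ofReal (φ1 i x η) * luxNormOn (ps i) (ball x η) (ωs i))
    (volume.restrict (Ioi t))

/-- The variable exponent condition `[φ⃗₁,φ₂]'' < ∞` (with log factor `(1+log(t/r))^k`). -/
def varPhiCond (k : ℕ) (ps : Fin m → Rn n → ℝ) (φ1 : Fin m → Rn n → ℝ → ℝ)
    (ωs : Fin m → Rn n → ℝ) (φ2 : Rn n → ℝ → ℝ) : Prop :=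
  (⨆ (x : Rn n) (r : ℝ) (_ : 0 < r),
    (ENNReal.ofReal (φ2 x r))⁻¹ *
      ∫⁻ t in Ioi r,
        ENNReal.ofReal (1 + Real.log (t / r)) ^ k * varEssInfProd ps φ1 ωs x t *
          (∏ i, luxNormOn (ps i) (ball x t) (ωs i))⁻¹ * (ENNReal.ofReal t)⁻¹) < ⊤

/-! ### Lebesgue norms on all of `ℝⁿ` -/

/-- `(∫ g^q)^(1/q)` for `ℝ≥0∞`-valued `g`. -/
def lpNormE (q : ℝ) (g : Rn n → ℝ≥0∞) : ℝ≥0∞ := (∫⁻ x, g x ^ q) ^ (1 / q)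

/-- The (unweighted) `L^q(ℝⁿ)` norm. -/
def lpNormRn (q : ℝ) (f : Rn n → ℝ) : ℝ≥0∞ := lpNormE q fun x => ENNReal.ofReal |f x|

/-! ### Quasi-Banach valued Calderón–Zygmund operators -/

/-- A quasi-norm making `E` a quasi-Banach space. -/
structure QBNorm (E : Type) [AddCommGroup E] [Module ℝ E] where
  N : E → ℝ
  nonneg : ∀ e, 0 ≤ N e
  eq_zero_iff : ∀ e, N e = 0 ↔ e = 0
  smul_eq : ∀ (c : ℝ) (e : E), N (c • e) = |c| * N e
  kappa : ℝ
  one_le_kappa : 1 ≤ kappa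
  quasi : ∀ e₁ e₂, N (e₁ + e₂) ≤ kappa * (N e₁ + N e₂)
  complete : ∀ u : ℕ → E,
    (∀ ε : ℝ, 0 < ε → ∃ M : ℕ, ∀ j k, M ≤ j → M ≤ k → N (u j - u k) < ε) →
    ∃ e : E, ∀ ε : ℝ, 0 < ε → ∃ M : ℕ, ∀ j, M ≤ j → N (u j - e) < ε

/-- An `m`-linear `𝔅`-valued Calderón–Zygmund operator on `ℝⁿ`, together with its kernel,
defined on products of generalized weighted Morrey spaces via the decomposition
`T(f⃗) = Σ_{α⃗} T(f₁^{α₁},…,f_m^{α_m})`. -/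
structure MultiCZB (n m : ℕ) (E : Type) [AddCommGroup E] [Module ℝ E] (Q : QBNorm E) where
  T : (Fin m → Rn n → ℝ) → Rn n → E
  K : Rn n → (Fin m → Rn n) → E
  add_coord : ∀ (f : Fin m → Rn n → ℝ) (i : Fin m) (g h : Rn n → ℝ) (x : Rn n),
    T (Function.update f i (g + h)) x = T (Function.update f i g) x + T (Function.update f i h) x
  smul_coord : ∀ (f : Fin m → Rn n → ℝ) (i : Fin m) (c : ℝ) (g : Rn n → ℝ) (x : Rn n),
    T (Function.update f i (c • g)) x = c • T (Function.update f i g) x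
  eps : ℝ
  eps_pos : 0 < eps
  A : ℝ≥0
  size : ∀ (x : Rn n) (y : Fin m → Rn n), 0 < ∑ j, dist x (y j) →
    ENNReal.ofReal (Q.N (K x y)) ≤ A * ENNReal.ofReal (∑ j, dist x (y j)) ^ (-(m * n : ℝ))
  reg_y : ∀ (x : Rn n) (y : Fin m → Rn n) (i : Fin m) (y' : Rn n),
    0 < ∑ j, dist x (y j) → dist (y i) y' ≤ (1 / 2) * ⨆ j, dist x (y j) →
    ENNReal.ofReal (Q.N (K x y - K x (Function.update y i y'))) ≤
      A * ENNReal.ofReal (dist (y i) y' ^ eps) *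
        ENNReal.ofReal (∑ j, dist x (y j)) ^ (-(m * n : ℝ) - eps)
  reg_x : ∀ (x x' : Rn n) (y : Fin m → Rn n),
    0 < ∑ j, dist x (y j) → dist x x' ≤ (1 / 2) * ∑ j, dist x (y j) →
    ENNReal.ofReal (Q.N (K x y - K x' y)) ≤
      A * ENNReal.ofReal (dist x x' ^ eps) *
        ENNReal.ofReal (∑ j, dist x (y j)) ^ (-(m * n : ℝ) - eps)
  dom : ∀ (f : Fin m → Rn n → ℝ) (x : Rn n), x ∉ ⋂ j, tsupport (f j) →
    ENNReal.ofReal (Q.N (T f x)) ≤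
      ∫⁻ y : Fin m → Rn n, (∏ i, ENNReal.ofReal |f i (y i)|) * ENNReal.ofReal (Q.N (K x y))
  decomp : ∀ (f : Fin m → Rn n → ℝ) (x₀ : Rn n) (r : ℝ), 0 < r → ∀ x ∈ ball x₀ r,
    T f x = ∑ α : Fin m → Bool,
      T (fun i => if α i then locInf x₀ r (f i) else loc0 x₀ r (f i)) x
  bddLq : ∃ (qs : Fin m → ℝ) (q : ℝ) (C : ℝ≥0), (∀ i, 1 ≤ qs i) ∧ q⁻¹ = ∑ i, (qs i)⁻¹ ∧
    ∀ f : Fin m → Rn n → ℝ,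
      lpNormE q (fun x => ENNReal.ofReal (Q.N (T f x))) ≤ C * ∏ i, lpNormRn (qs i) (f i)

/-! ### Multilinear Littlewood–Paley square operators -/

/-- `K_t(x,y⃗) = t^{-mn} K(x/t, y₁/t, …, y_m/t)`. -/
def Kt (m : ℕ) (K : Rn n → (Fin m → Rn n) → ℝ) (t : ℝ) (x : Rn n)
    (y : Fin m → Rn n) : ℝ :=
  t ^ (-(m * n : ℝ)) * K (t⁻¹ • x) fun i => t⁻¹ • y i

/-- The multilinear square operator
`T(f⃗)(x) = (∫₀^∞ |∫ K_t(x,y⃗) ∏ fⱼ(yⱼ) dy⃗|² dt/t)^{1/2}`. -/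
def sqFn (K : Rn n → (Fin m → Rn n) → ℝ) (f : Fin m → Rn n → ℝ) (x : Rn n) : ℝ≥0∞ :=
  (∫⁻ t in Ioi (0 : ℝ),
      ENNReal.ofReal |∫ y : Fin m → Rn n, Kt m K t x y * ∏ i, f i (y i)| ^ (2 : ℝ) *
        (ENNReal.ofReal t)⁻¹) ^ (1 / 2 : ℝ)

/-- `θ ∈ Dini(1)`: nondecreasing on `[0,∞)`, `0 < θ(1) < ∞`, `∫₀¹ θ(t)/t dt < ∞`. -/
def IsDiniFn (θ : ℝ → ℝ) : Prop :=
  (∀ t, 0 ≤ θ t) ∧ MonotoneOn θ (Ici 0) ∧ 0 < θ 1 ∧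
    (∫⁻ t in Ioo (0 : ℝ) 1, ENNReal.ofReal (θ t) * (ENNReal.ofReal t)⁻¹) < ⊤

/-- `K` is a square-function kernel of type `θ`. -/
def SqKernelType (K : Rn n → (Fin m → Rn n) → ℝ) (θ : ℝ → ℝ) : Prop :=
  ∃ A : ℝ≥0,
    (∀ (x : Rn n) (y : Fin m → Rn n), 0 < ∑ j, dist x (y j) →
      (∫⁻ t in Ioi (0 : ℝ),
          ENNReal.ofReal |Kt m K t x y| ^ (2 : ℝ) * (ENNReal.ofReal t)⁻¹) ^ (1 / 2 : ℝ) ≤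
        A * ENNReal.ofReal (∑ j, dist x (y j)) ^ (-(m * n : ℝ))) ∧
    (∀ (x : Rn n) (y : Fin m → Rn n) (i : Fin m) (y' : Rn n), 0 < ∑ j, dist x (y j) →
      dist (y i) y' ≤ (1 / 2) * ⨆ j, dist x (y j) →
      (∫⁻ t in Ioi (0 : ℝ),
          ENNReal.ofReal |Kt m K t x y - Kt m K t x (Function.update y i y')| ^ (2 : ℝ) *
            (ENNReal.ofReal t)⁻¹) ^ (1 / 2 : ℝ) ≤
        A * ENNReal.ofReal (∑ j, dist x (y j)) ^ (-(m * n : ℝ)) *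
          ENNReal.ofReal (θ (dist (y i) y' / ∑ j, dist x (y j)))) ∧
    (∀ (x z : Rn n) (y : Fin m → Rn n), 0 < ∑ j, dist x (y j) →
      dist z x ≤ (1 / 2) * ⨆ j, dist x (y j) →
      (∫⁻ t in Ioi (0 : ℝ),
          ENNReal.ofReal |Kt m K t z y - Kt m K t x y| ^ (2 : ℝ) *
            (ENNReal.ofReal t)⁻¹) ^ (1 / 2 : ℝ) ≤
        A * ENNReal.ofReal (∑ j, dist x (y j)) ^ (-(m * n : ℝ)) *
          ENNReal.ofReal (θ (dist z x / ∑ j, dist x (y j))))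

/-- The assumed `L^{q₁} × ⋯ × L^{q_m} → L^q` boundedness of the square operator. -/
def SqBddLq (K : Rn n → (Fin m → Rn n) → ℝ) : Prop :=
  ∃ (qs : Fin m → ℝ) (q : ℝ) (C : ℝ≥0), (∀ i, 1 < qs i) ∧ q⁻¹ = ∑ i, (qs i)⁻¹ ∧
    ∀ f : Fin m → Rn n → ℝ, lpNormE q (sqFn K f) ≤ C * ∏ i, lpNormRn (qs i) (f i)

/-- A multilinear Littlewood–Paley kernel. -/
def IsMLPKernel (K : Rn n → (Fin m → Rn n) → ℝ) : Prop :=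
  ∃ A γ δ B₁ : ℝ, 0 < A ∧ 0 < γ ∧ 0 < δ ∧ 0 < B₁ ∧
    (∀ (x : Rn n) (y : Fin m → Rn n),
      |K x y| ≤ A * (1 + ∑ j, dist x (y j)) ^ (-(m * n : ℝ) - δ)) ∧
    (∀ (x : Rn n) (y : Fin m → Rn n) (i : Fin m) (y' : Rn n),
      dist (y i) y' ≤ dist x (y i) / B₁ →
      |K x y - K x (Function.update y i y')| ≤
        A * dist (y i) y' ^ γ * (1 + ∑ j, dist x (y j)) ^ (-(m * n : ℝ) - δ - γ)) ∧
    (∀ (x x' : Rn n) (y : Fin m → Rn n),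
      dist x x' ≤ (⨆ j, dist x (y j)) / B₁ →
      |K x y - K x' y| ≤
        A * dist x x' ^ γ * (1 + ∑ j, dist x (y j)) ^ (-(m * n : ℝ) - δ - γ))

/-- The multilinear Littlewood–Paley `g*_λ` function. -/
def glam (K : Rn n → (Fin m → Rn n) → ℝ) (lam : ℝ) (f : Fin m → Rn n → ℝ)
    (x : Rn n) : ℝ≥0∞ :=
  (∫⁻ t in Ioi (0 : ℝ), ∫⁻ z : Rn n,
      ENNReal.ofReal (t / (dist x z + t)) ^ (n * lam) *
        ENNReal.ofReal |∫ y : Fin m → Rn n, Kt m K t z y * ∏ i, f i (y i)| ^ (2 : ℝ) *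
          (ENNReal.ofReal t) ^ (-(n : ℝ) - 1)) ^ (1 / 2 : ℝ)

/-- The assumed `L^{q₁} × ⋯ × L^{q_m} → L^q` boundedness of the `g*_λ` function. -/
def GlamBddLq (K : Rn n → (Fin m → Rn n) → ℝ) (lam : ℝ) : Prop :=
  ∃ (qs : Fin m → ℝ) (q : ℝ) (C : ℝ≥0), (∀ i, 1 < qs i) ∧ q⁻¹ = ∑ i, (qs i)⁻¹ ∧
    ∀ f : Fin m → Rn n → ℝ, lpNormE q (glam K lam f) ≤ C * ∏ i, lpNormRn (qs i) (f i)

/-- A multilinear Marcinkiewicz kernel. -/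
def IsMarcinkiewiczKernel (K : Rn n → (Fin m → Rn n) → ℝ) : Prop :=
  ∃ A γ δ B₁ : ℝ, 0 < A ∧ 0 < γ ∧ 0 < δ ∧ δ < m * n ∧ 0 < B₁ ∧
    (∀ (x : Rn n) (y : Fin m → Rn n), ¬ (∑ j, dist x (y j) ^ 2) ≤ 1 → K x y = 0) ∧
    (∀ (x : Rn n) (y : Fin m → Rn n), 0 < ∑ j, dist x (y j) →
      |K x y| ≤ A * (∑ j, dist x (y j)) ^ (-(m * n : ℝ) + δ)) ∧
    (∀ (x : Rn n) (y : Fin m → Rn n) (i : Fin m) (y' : Rn n),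
      (∑ j, dist x (y j) ^ 2) ≤ 1 → 0 < ∑ j, dist x (y j) →
      dist (y i) y' ≤ dist x (y i) / B₁ →
      |K x y - K x (Function.update y i y')| ≤
        A * dist (y i) y' ^ γ * (∑ j, dist x (y j)) ^ (-(m * n : ℝ) + δ - γ)) ∧
    (∀ (x x' : Rn n) (y : Fin m → Rn n),
      (∑ j, dist x (y j) ^ 2) ≤ 1 → 0 < ∑ j, dist x (y j) →
      dist x x' ≤ (⨆ j, dist x (y j)) / B₁ →
      |K x y - K x' y| ≤
        A * dist x x' ^ γ * (∑ j, dist x (y j)) ^ (-(m * n : ℝ) + δ - γ))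

/-- `|z⃗| = (Σ |zᵢ|²)^{1/2}` on `(ℝⁿ)^m`. -/
def rho (m : ℕ) (z : Fin m → Rn n) : ℝ := Real.sqrt (∑ i, ‖z i‖ ^ 2)

/-- A multilinear Marcinkiewicz kernel of convolution type with homogeneous `Ω`. -/
def IsConvHomogMarcinkiewicz (K : Rn n → (Fin m → Rn n) → ℝ) : Prop :=
  IsMarcinkiewiczKernel K ∧
  ∃ (Kc : (Fin m → Rn n) → ℝ) (Ω : (Fin m → Rn n) → ℝ) (δ : ℝ),
    0 < δ ∧ δ < m * n ∧
    (∀ (x : Rn n) (y : Fin m → Rn n), K x y = Kc fun i => x - y i) ∧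
    (∀ (c : ℝ) (z : Fin m → Rn n), 0 < c → Ω (c • z) = Ω z) ∧
    (∀ z : Fin m → Rn n, Kc z = if rho m z ≤ 1 then Ω z * rho m z ^ (δ - m * n) else 0)
/-! ### Scalar (complex) multilinear operators: norms, commutators, conclusions -/

/-- View a real function as a complex one. -/
def cToC (f : Rn n → ℝ) : Rn n → ℂ := fun y => (f y : ℂ)

/-- `x ↦ |T(f⃗)(x)|` for a complex-valued multilinear operator applied to real data. -/
def cNorm (Tc : (Fin m → Rn n → ℂ) → Rn n → ℂ) (f : Fin m → Rn n → ℝ) : Rn n → ℝ≥0∞ :=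
  fun x => ENNReal.ofReal ‖Tc (fun i => cToC (f i)) x‖

/-- `x ↦ |T_{Πb⃗}(f⃗)(x)|`. -/
def cIterComm (Tc : (Fin m → Rn n → ℂ) → Rn n → ℂ) (b f : Fin m → Rn n → ℝ) :
    Rn n → ℝ≥0∞ :=
  fun x => ENNReal.ofReal ‖Tc (fun i y => (((b i x - b i y) * f i y : ℝ) : ℂ)) x‖

/-- `x ↦ |T_{Σb⃗}(f⃗)(x)|`. -/
def cSumComm (Tc : (Fin m → Rn n → ℂ) → Rn n → ℂ) (b f : Fin m → Rn n → ℝ) :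
    Rn n → ℝ≥0∞ :=
  fun x => ENNReal.ofReal
    ‖∑ j, Tc (Function.update (fun i => cToC (f i)) j
        fun y => (((b j x - b j y) * f j y : ℝ) : ℂ)) x‖

/-- The boundedness conclusions of Theorems 4.1–4.3 for a complex `m`-linear operator:
strong and weak type on generalized weighted Morrey spaces under `[φ⃗₁,φ₂]₁ < ∞`, and
boundedness of the iterated/multilinear commutators under `[φ⃗₁,φ₂]₂ < ∞` resp.
`[φ⃗₁,φ₂]₃ < ∞`. -/
def Thm41to43Concl (m : ℕ) (Tc : (Fin m → Rn n → ℂ) → Rn n → ℂ) : Prop :=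
  ∀ (ps : Fin m → ℝ) (p : ℝ) (ωs : Fin m → Rn n → ℝ)
    (φ1 : Fin m → Rn n → ℝ → ℝ) (φ2 : Rn n → ℝ → ℝ),
    (∀ k, 1 ≤ ps k) → p⁻¹ = ∑ k, (ps k)⁻¹ → (∀ i, IsWeight (ωs i)) →
    IsMultiAP p ps ωs → (∀ i, IsAinf (ωs i)) →
    (∀ i x r, 0 < r → 0 ≤ φ1 i x r) → (∀ x r, 0 < r → 0 ≤ φ2 x r) →
    ((phiCond 0 ps φ1 ωs φ2 →
      ((∀ k, 1 < ps k) → ∃ C : ℝ≥0, ∀ f : Fin m → Rn n → ℝ,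
        (∀ i, MemMorrey (ps i) (φ1 i) (ωs i) (f i)) →
        morreyNormE p φ2 (nuw p ps ωs) (cNorm Tc f) ≤
          C * ∏ i, morreyNorm (ps i) (φ1 i) (ωs i) (f i)) ∧
      ((∃ k, ps k = 1) → ∃ C : ℝ≥0, ∀ f : Fin m → Rn n → ℝ,
        (∀ i, MemMorrey (ps i) (φ1 i) (ωs i) (f i)) →
        weakMorreyNormE p φ2 (nuw p ps ωs) (cNorm Tc f) ≤
          C * ∏ i, morreyNorm (ps i) (φ1 i) (ωs i) (f i))) ∧
    ((∀ k, 1 < ps k) → ∀ b : Fin m → Rn n → ℝ, (∀ j, MemBMO (b j)) →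
      (phiCond m ps φ1 ωs φ2 → ∃ C : ℝ≥0, ∀ f : Fin m → Rn n → ℝ,
        (∀ i, MemMorrey (ps i) (φ1 i) (ωs i) (f i)) →
        morreyNormE p φ2 (nuw p ps ωs) (cIterComm Tc b f) ≤
          C * ∏ i, morreyNorm (ps i) (φ1 i) (ωs i) (f i)) ∧
      (phiCond 1 ps φ1 ωs φ2 → ∃ C : ℝ≥0, ∀ f : Fin m → Rn n → ℝ,
        (∀ i, MemMorrey (ps i) (φ1 i) (ωs i) (f i)) →
        morreyNormE p φ2 (nuw p ps ωs) (cSumComm Tc b f) ≤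
          C * ∏ i, morreyNorm (ps i) (φ1 i) (ωs i) (f i))))

/-! ### Multilinear pseudo-differential operators -/

/-- Standard basis directions in `ℝⁿ × (ℝⁿ)^m`: `inl i` is the `i`-th direction in the
`x`-variable, `inr (j,i)` the `i`-th direction in the `j`-th `ξ`-variable. -/
def dirVec (n m : ℕ) : Fin n ⊕ Fin m × Fin n → Rn n × (Fin m → Rn n)
  | Sum.inl i => (EuclideanSpace.single i 1, 0)
  | Sum.inr ji => (0, Pi.single ji.1 (EuclideanSpace.single ji.2 1))

/-- The multilinear Hörmander class `S⁰`: smooth with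
`|∂_x^α ∂_{ξ⃗}^{β⃗} σ| ≤ C (1+Σ|ξᵢ|)^{|α| - |β⃗|}`. -/
def SymbolClass (m : ℕ) (σ : Rn n × (Fin m → Rn n) → ℂ) : Prop :=
  ContDiff ℝ (⊤ : ℕ∞) σ ∧
  ∀ (k : ℕ) (d : Fin k → Fin n ⊕ Fin m × Fin n), ∃ C : ℝ,
    ∀ (x : Rn n) (ξ : Fin m → Rn n),
      ‖iteratedFDeriv ℝ k σ (x, ξ) fun j => dirVec n m (d j)‖ ≤
        C * (1 + ∑ i, ‖ξ i‖) ^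
          (((Finset.univ.filter fun j => (d j).isLeft = true).card : ℝ) -
            ((Finset.univ.filter fun j => (d j).isRight = true).card : ℝ))

/-- The `m`-linear pseudo-differential operator with symbol `σ`. -/
def Tpseudo (m : ℕ) (σ : Rn n × (Fin m → Rn n) → ℂ) (f : Fin m → Rn n → ℂ)
    (x : Rn n) : ℂ :=
  ∫ ξ : Fin m → Rn n,
    σ (x, ξ) * (∏ i, 𝓕 (f i) (ξ i)) *
      Complex.exp (2 * Real.pi * Complex.I * ((∑ i, (inner ℝ x (ξ i) : ℝ) : ℝ) : ℂ))

/-- `T'` is the `j`-th transpose of `T`. -/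
def IsTransposeOf (m : ℕ) (T T' : (Fin m → Rn n → ℂ) → Rn n → ℂ) (j : Fin m) : Prop :=
  ∀ (f : Fin m → Rn n → ℂ) (g : Rn n → ℂ),
    (∀ i, ContDiff ℝ (⊤ : ℕ∞) (f i) ∧ HasCompactSupport (f i)) →
    ContDiff ℝ (⊤ : ℕ∞) g → HasCompactSupport g →
    ∫ x, T f x * g x = ∫ x, T' (Function.update f j g) x * f j x

/-! ### Paraproducts -/

/-- `Ψ_t(x) = t^{-n} Ψ(x/t)`. -/
def dilat (Ψ : Rn n → ℂ) (t : ℝ) : Rn n → ℂ :=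
  fun x => ((t ^ (-(n : ℝ)) : ℝ) : ℂ) * Ψ (t⁻¹ • x)

/-- The Littlewood–Paley piece `Δ_j^Ψ f = f * Ψ_{2^{-j}}`. -/
def DeltaJ (Ψ : Rn n → ℂ) (j : ℤ) (f : Rn n → ℂ) : Rn n → ℂ :=
  fun x => ∫ y, f y * dilat Ψ ((2 : ℝ) ^ (-j)) (x - y)

/-- The partial sum `S_j f = Σ_{k ≤ j} Δ_k^Ψ f`. -/
def SJ (Ψ : Rn n → ℂ) (j : ℤ) (f : Rn n → ℂ) : Rn n → ℂ :=
  fun x => ∑' k : ℤ, if k ≤ j then DeltaJ Ψ k f x else 0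

/-- The bilinear paraproduct `Π₂(f₁,f₂) = Σ_j Δ_j^Ψ(f₁) S_j(f₂)`. -/
def paraprod2 (Ψ : Rn n → ℂ) : (Fin 2 → Rn n → ℂ) → Rn n → ℂ :=
  fun f x => ∑' j : ℤ, DeltaJ Ψ j (f 0) x * SJ Ψ j (f 1) x

/-- The trilinear paraproduct `Π₃(f₁,f₂,f₃) = Σ_j Δ_j^Ψ(f₁) S_j(f₂) S_j(f₃)`. -/
def paraprod3 (Ψ : Rn n → ℂ) : (Fin 3 → Rn n → ℂ) → Rn n → ℂ :=
  fun f x => ∑' j : ℤ, DeltaJ Ψ j (f 0) x * SJ Ψ j (f 1) x * SJ Ψ j (f 2) x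

/-- `Ψ` is a Schwartz function whose Fourier transform is supported in the annulus
`6/7 ≤ |ξ| ≤ 2` and equal to `1` on `1 ≤ |ξ| ≤ 12/7`. -/
def IsLPBump (Ψ : Rn n → ℂ) : Prop :=
  (∃ S : SchwartzMap (Rn n) ℂ, Ψ = ⇑S) ∧
  Function.support (𝓕 Ψ) ⊆ {ξ : Rn n | 6 / 7 ≤ ‖ξ‖ ∧ ‖ξ‖ ≤ 2} ∧
  ∀ ξ : Rn n, 1 ≤ ‖ξ‖ → ‖ξ‖ ≤ 12 / 7 → 𝓕 Ψ ξ = 1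

/-! ### The Luxemburg norm and the modular -/

lemma indicator_modular (p : Rn n → ℝ) (hp : ∀ x, 0 < p x) (E : Set (Rn n)) (f : Rn n → ℝ)
    (lam : ℝ≥0∞) :
    (fun x => (ENNReal.ofReal |E.indicator f x| / lam) ^ p x) =
      E.indicator fun x => (ENNReal.ofReal |f x| / lam) ^ p x := by
  funext x
  by_cases hx : x ∈ E
  · simp [hx]
  · simp [hx, hp x]

lemma luxNormOn_le {p : Rn n → ℝ} (hp : ∀ x, 0 < p x) {E : Set (Rn n)} (hE : MeasurableSet E)
    {f : Rn n → ℝ} {lam : ℝ≥0∞} (h0 : lam ≠ 0)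
    (h : ∫⁻ x in E, (ENNReal.ofReal |f x| / lam) ^ p x ≤ 1) : luxNormOn p E f ≤ lam := by
  unfold luxNormOn luxNorm
  refine iInf_le_of_le lam (iInf_le_of_le h0 (iInf_le_of_le ?_ le_rfl))
  rwa [indicator_modular p hp, lintegral_indicator hE]

lemma le_luxNormOn {p : Rn n → ℝ} (hp : ∀ x, 0 < p x) {E : Set (Rn n)} (hE : MeasurableSet E)
    {f : Rn n → ℝ} {c : ℝ≥0∞}
    (h : ∀ lam : ℝ≥0∞, lam ≠ 0 → ∫⁻ x in E, (ENNReal.ofReal |f x| / lam) ^ p x ≤ 1 → c ≤ lam) :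
    c ≤ luxNormOn p E f := by
  unfold luxNormOn luxNorm
  refine le_iInf fun lam => le_iInf fun h0 => le_iInf fun h1 => h lam h0 ?_
  rwa [indicator_modular p hp, lintegral_indicator hE] at h1

/-- Hölder's inequality for the pair `v`, `v⁻¹`. -/
lemma volume_le_of_modular_le {q : Rn n → ℝ} (hq : ∀ x, 1 < q x) (hqm : Measurable q)
    {v : Rn n → ℝ} (hvm : AEMeasurable v) (hv : ∀ᵐ x : Rn n, 0 < v x) {F : Set (Rn n)}
    {a b : ℝ≥0∞} (ha0 : a ≠ 0) (ha : a ≠ ⊤) (hb0 : b ≠ 0) (hb : b ≠ ⊤)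
    (h1 : ∫⁻ x in F, (ENNReal.ofReal |v x| / a) ^ q x ≤ 1)
    (h2 : ∫⁻ x in F, (ENNReal.ofReal |(v x)⁻¹| / b) ^ conjExp q x ≤ 1) :
    volume F ≤ 2 * a * b := by
  have key : ∀ᵐ x ∂(volume.restrict F), (a * b)⁻¹ ≤ (ENNReal.ofReal |v x| / a) ^ q x +
      (ENNReal.ofReal |(v x)⁻¹| / b) ^ conjExp q x := by
    filter_upwards [ae_restrict_of_ae hv] with x hx
    have hc : (q x).HolderConjugate (conjExp q x) := Real.HolderConjugate.conjExponent (hq x)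
    have h := ENNReal.young_inequality (ENNReal.ofReal |v x| / a) (ENNReal.ofReal |(v x)⁻¹| / b) hc
    have e : (a * b)⁻¹ = (ENNReal.ofReal |v x| / a) * (ENNReal.ofReal |(v x)⁻¹| / b) := by
      rw [abs_of_pos hx, abs_of_pos (inv_pos.2 hx), ENNReal.ofReal_inv_of_pos hx, div_eq_mul_inv,
        div_eq_mul_inv, mul_mul_mul_comm,
        ENNReal.mul_inv_cancel (by simpa using hx) ENNReal.ofReal_ne_top, one_mul,
        ENNReal.mul_inv (Or.inl ha0) (Or.inl ha)]
    rw [e]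
    refine h.trans (add_le_add ?_ ?_)
    · refine ENNReal.div_le_of_le_mul (le_mul_of_one_le_right' ?_)
      rw [ENNReal.one_le_ofReal]; exact hc.lt.le
    · refine ENNReal.div_le_of_le_mul (le_mul_of_one_le_right' ?_)
      rw [ENNReal.one_le_ofReal]; exact hc.symm.lt.le
  have h := lintegral_mono_ae key
  rw [lintegral_const, Measure.restrict_apply_univ, lintegral_add_left'] at h
  · have h3 := h.trans (add_le_add h1 h2)
    have hab0 : a * b ≠ 0 := mul_ne_zero ha0 hb0
    have hab : a * b ≠ ⊤ := ENNReal.mul_ne_top ha hb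
    rw [mul_comm, ← div_eq_mul_inv, ENNReal.div_le_iff hab0 hab] at h3
    calc volume F ≤ _ := h3
      _ = _ := by rw [one_add_one_eq_two, mul_assoc]
  · have := hvm.restrict (s := F)
    exact ((this.abs.ennreal_ofReal).div_const a).pow hqm.aemeasurable

/-- The `A_{q(·)}` condition tested on subsets of a ball. -/
lemma IsAvar.volume_mul_luxNormOn_le {q : Rn n → ℝ} (hq : ∀ x, 1 < q x) (hqm : Measurable q)
    {v : Rn n → ℝ} (hvm : AEMeasurable v) (hv : ∀ᵐ x : Rn n, 0 < v x) {C : ℝ≥0}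
    (hC : ∀ (x : Rn n) (r : ℝ), 0 < r → (volume (ball x r))⁻¹ * luxNormOn q (ball x r) v *
      luxNormOn (conjExp q) (ball x r) (fun y => (v y)⁻¹) ≤ C)
    (x : Rn n) {r : ℝ} (hr : 0 < r) {F : Set (Rn n)} (hF : F ⊆ ball x r)
    {lam : ℝ≥0∞} (h0 : lam ≠ 0) (ht : lam ≠ ⊤)
    (h1 : ∫⁻ y in F, (ENNReal.ofReal |v y| / lam) ^ q y ≤ 1) :
    volume F * luxNormOn q (ball x r) v ≤ 2 * C * lam * volume (ball x r) := by
  have hc : ∀ x, 0 < conjExp q x := fun x =>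
    div_pos (by linarith [hq x]) (by linarith [hq x])
  have hle : volume F / (2 * lam) ≤ luxNormOn (conjExp q) (ball x r) (fun y => (v y)⁻¹) := by
    refine le_luxNormOn hc measurableSet_ball fun mu hmu h2 => ?_
    rcases eq_or_ne mu ⊤ with rfl | hmt
    · exact le_top
    · refine ENNReal.div_le_of_le_mul ?_
      rw [mul_comm]
      exact volume_le_of_modular_le hq hqm hvm hv h0 ht hmu hmt h1
        ((lintegral_mono_set hF).trans h2)
  have hB0 : volume (ball x r) ≠ 0 := (measure_ball_pos _ _ hr).ne'
  have hBt : volume (ball x r) ≠ ⊤ := measure_ball_lt_top.ne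
  have h2l0 : 2 * lam ≠ 0 := mul_ne_zero two_ne_zero h0
  have h2lt : 2 * lam ≠ ⊤ := ENNReal.mul_ne_top ENNReal.ofNat_ne_top ht
  have h3 := (mul_le_mul_right hle ((volume (ball x r))⁻¹ * luxNormOn q (ball x r) v)).trans
    (hC x r hr)
  have e : (volume (ball x r))⁻¹ * luxNormOn q (ball x r) v * (volume F / (2 * lam)) =
      volume F * luxNormOn q (ball x r) v / (volume (ball x r) * (2 * lam)) := by
    rw [div_eq_mul_inv, div_eq_mul_inv, ENNReal.mul_inv (Or.inl hB0) (Or.inl hBt)]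
    ring
  rw [e, ENNReal.div_le_iff (mul_ne_zero hB0 h2l0) (ENNReal.mul_ne_top hBt h2lt)] at h3
  calc _ ≤ _ := h3
    _ = _ := by ring

lemma IsAvar.luxNormOn_lt_top {q : Rn n → ℝ} (hq : ∀ x, 1 < q x) (hqm : Measurable q)
    {v : Rn n → ℝ} (hvm : AEMeasurable v) (hv : ∀ᵐ x : Rn n, 0 < v x) {C : ℝ≥0}
    (hC : ∀ (x : Rn n) (r : ℝ), 0 < r → (volume (ball x r))⁻¹ * luxNormOn q (ball x r) v *
      luxNormOn (conjExp q) (ball x r) (fun y => (v y)⁻¹) ≤ C)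
    (x : Rn n) {r : ℝ} (hr : 0 < r) : luxNormOn q (ball x r) v < ⊤ := by
  obtain ⟨g, hg, hgv⟩ := hvm
  have hB0 : volume (ball x r) ≠ 0 := (measure_ball_pos _ _ hr).ne'
  have hBt : volume (ball x r) ≠ ⊤ := measure_ball_lt_top.ne
  obtain ⟨k, hk⟩ : ∃ k : ℕ, volume (ball x r ∩ {y | |g y| ≤ k}) ≠ 0 := by
    by_contra! hcon
    apply hB0
    refine measure_mono_null ?_ (measure_iUnion_null hcon)
    intro y hy
    obtain ⟨k, hk⟩ := exists_nat_ge |g y|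
    exact mem_iUnion.2 ⟨k, hy, hk⟩
  set F := ball x r ∩ {y | |g y| ≤ k} with hFdef
  have hFm : MeasurableSet F := measurableSet_ball.inter (measurableSet_le hg.abs measurable_const)
  set lam : ℝ≥0∞ := (k + 1) * (1 + volume (ball x r)) with hlam
  have hl0 : lam ≠ 0 := by simp [hlam]
  have hlt : lam ≠ ⊤ := ENNReal.mul_ne_top (by finiteness) (by finiteness)
  have h1 : ∫⁻ y in F, (ENNReal.ofReal |v y| / lam) ^ q y ≤ 1 := by
    have : ∀ᵐ y ∂(volume.restrict F), (ENNReal.ofReal |v y| / lam) ^ q y ≤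
        (1 + volume (ball x r))⁻¹ := by
      rw [ae_restrict_iff' hFm]
      filter_upwards [hgv] with y hy hyF
      have h2 : ENNReal.ofReal |v y| ≤ k + 1 := by
        rw [hy]
        calc ENNReal.ofReal |g y| ≤ ENNReal.ofReal k := ENNReal.ofReal_le_ofReal hyF.2
          _ = k := ENNReal.ofReal_natCast k
          _ ≤ k + 1 := le_self_add
      have h3 : ENNReal.ofReal |v y| / lam ≤ (1 + volume (ball x r))⁻¹ := by
        refine ENNReal.div_le_of_le_mul (h2.trans (le_of_eq ?_))
        rw [hlam, mul_left_comm, ENNReal.inv_mul_cancel (by simp) (by finiteness), mul_one]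
      have h4 : ENNReal.ofReal |v y| / lam ≤ 1 := h3.trans (ENNReal.inv_le_one.2 le_self_add)
      exact (ENNReal.rpow_le_self_of_le_one h4 (hq y).le).trans h3
    refine (lintegral_mono_ae this).trans ?_
    rw [lintegral_const, Measure.restrict_apply_univ, mul_comm, ← div_eq_mul_inv]
    refine ENNReal.div_le_of_le_mul ?_
    rw [one_mul]
    exact (measure_mono inter_subset_left).trans le_add_self
  have h := IsAvar.volume_mul_luxNormOn_le hq hqm ⟨g, hg, hgv⟩ hv hC x hr inter_subset_left
    hl0 hlt h1
  by_contra hcon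
  rw [not_lt, top_le_iff] at hcon
  rw [hcon, ENNReal.mul_top hk, top_le_iff] at h
  exact ENNReal.mul_ne_top (ENNReal.mul_ne_top (by finiteness) hlt) hBt h

/-! ### Dyadic grids -/

/-- The index of the cell of side `L / 2 ^ k` containing `x`, in the dyadic grid anchored
at `a`. -/
def gridIdx (a : Rn n) (L : ℝ) (k : ℕ) (x : Rn n) : Fin n → ℤ :=
  fun i => ⌊(x i - a i) / (L / 2 ^ k)⌋

/-- The half-open cube of generation `c.1` and index `c.2`. -/
def cell (a : Rn n) (L : ℝ) (c : ℕ × (Fin n → ℤ)) : Set (Rn n) := {x | gridIdx a L c.1 x = c.2}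

/-- The cell of generation `k` containing `x`. -/
def cellAt (a : Rn n) (L : ℝ) (k : ℕ) (x : Rn n) : ℕ × (Fin n → ℤ) := (k, gridIdx a L k x)

lemma mem_cellAt (a : Rn n) (L : ℝ) (k : ℕ) (x : Rn n) : x ∈ cell a L (cellAt a L k x) := rfl

lemma cellAt_eq {a : Rn n} {L : ℝ} {c : ℕ × (Fin n → ℤ)} {x : Rn n} (h : x ∈ cell a L c) :
    cellAt a L c.1 x = c := Prod.ext rfl h

lemma gridIdx_eq_of_le {a : Rn n} {L : ℝ} {i j : ℕ} (hij : i ≤ j) {x y : Rn n}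
    (h : gridIdx a L j x = gridIdx a L j y) : gridIdx a L i x = gridIdx a L i y := by
  have key : ∀ z : Rn n, gridIdx a L i z = fun s => gridIdx a L j z s / ((2 ^ (j - i) : ℕ) : ℤ) := by
    intro z
    funext s
    unfold gridIdx
    rw [← Int.floor_div_natCast]
    congr 1
    obtain ⟨d, rfl⟩ := Nat.exists_eq_add_of_le hij
    simp only [Nat.add_sub_cancel_left, pow_add]
    push_cast
    rcases eq_or_ne L 0 with rfl | hL
    · simp
    · field_simp
  rw [key x, key y, h]

lemma cell_subset_of_le {a : Rn n} {L : ℝ} {c d : ℕ × (Fin n → ℤ)} (h : c.1 ≤ d.1) {x : Rn n}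
    (hc : x ∈ cell a L c) (hd : x ∈ cell a L d) : cell a L d ⊆ cell a L c := by
  intro y hy
  have : gridIdx a L d.1 y = gridIdx a L d.1 x := Eq.trans hy (Eq.symm hd)
  exact (gridIdx_eq_of_le h this).trans hc

lemma mem_cell_iff {a : Rn n} {L : ℝ} (hL : 0 < L) {c : ℕ × (Fin n → ℤ)} {x : Rn n} :
    x ∈ cell a L c ↔ ∀ i, x i ∈ Ico (a i + c.2 i * (L / 2 ^ c.1))
      (a i + c.2 i * (L / 2 ^ c.1) + L / 2 ^ c.1) := by
  have hs : 0 < L / 2 ^ c.1 := by positivity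
  simp only [cell, gridIdx, mem_ofPred_eq, funext_iff, Int.floor_eq_iff, mem_Ico]
  refine forall_congr' fun i => ?_
  rw [le_div_iff₀ hs, div_lt_iff₀ hs]
  constructor <;> rintro ⟨h1, h2⟩ <;> constructor <;> linarith

lemma cell_eq_preimage {a : Rn n} {L : ℝ} (hL : 0 < L) (c : ℕ × (Fin n → ℤ)) :
    cell a L c = (@WithLp.ofLp 2 (Fin n → ℝ)) ⁻¹' (univ.pi fun i =>
      Ico (a i + c.2 i * (L / 2 ^ c.1)) (a i + c.2 i * (L / 2 ^ c.1) + L / 2 ^ c.1)) := by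
  ext x
  rw [mem_cell_iff hL]
  simp

lemma measurableSet_cell {a : Rn n} {L : ℝ} (hL : 0 < L) (c : ℕ × (Fin n → ℤ)) :
    MeasurableSet (cell a L c) := by
  rw [cell_eq_preimage hL]
  exact (PiLp.volume_preserving_ofLp (Fin n)).measurable
    (MeasurableSet.univ_pi fun i => measurableSet_Ico)

lemma volume_cell {a : Rn n} {L : ℝ} (hL : 0 < L) (c : ℕ × (Fin n → ℤ)) :
    volume (cell a L c) = ENNReal.ofReal ((L / 2 ^ c.1) ^ n) := by
  rw [cell_eq_preimage hL, (PiLp.volume_preserving_ofLp (Fin n)).measure_preimage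
    (MeasurableSet.univ_pi fun i => measurableSet_Ico).nullMeasurableSet, Real.volume_pi_Ico]
  simp [ENNReal.ofReal_pow (by positivity : 0 ≤ L / 2 ^ c.1)]

lemma volume_cell_ne_zero {a : Rn n} {L : ℝ} (hL : 0 < L) (c : ℕ × (Fin n → ℤ)) :
    volume (cell a L c) ≠ 0 := by
  rw [volume_cell hL, ENNReal.ofReal_ne_zero_iff]
  positivity

lemma volume_cell_ne_top {a : Rn n} {L : ℝ} (hL : 0 < L) (c : ℕ × (Fin n → ℤ)) :
    volume (cell a L c) ≠ ⊤ := by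
  rw [volume_cell hL]
  exact ENNReal.ofReal_ne_top

lemma dist_le_of_coord {x y : Rn n} {s : ℝ} (h : ∀ i, |x i - y i| ≤ s) : dist x y ≤ n * s := by
  have h1 : ‖x - y‖ ≤ ∑ i, ‖(x - y) i‖ := by
    have := EuclideanSpace.norm_eq (x - y)
    rw [this]
    refine Real.sqrt_le_iff.2 ⟨by positivity, ?_⟩
    exact Finset.sum_sq_le_sq_sum_of_nonneg fun i _ => norm_nonneg _
  rw [dist_eq_norm]
  refine h1.trans ?_
  calc ∑ i, ‖(x - y) i‖ ≤ ∑ _i : Fin n, s := Finset.sum_le_sum fun i _ => h i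
    _ = n * s := by simp

lemma dist_le_of_mem_cell {a : Rn n} {L : ℝ} (hL : 0 < L) {c : ℕ × (Fin n → ℤ)} {x y : Rn n}
    (hx : x ∈ cell a L c) (hy : y ∈ cell a L c) : dist x y ≤ n * (L / 2 ^ c.1) := by
  rw [mem_cell_iff hL] at hx hy
  refine dist_le_of_coord fun i => ?_
  have h1 := hx i
  have h2 := hy i
  rw [abs_le]
  constructor <;> linarith [h1.1, h1.2, h2.1, h2.2]

lemma cell_subset_ball {a : Rn n} {L : ℝ} (hL : 0 < L) {c : ℕ × (Fin n → ℤ)} {x : Rn n}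
    (hx : x ∈ cell a L c) : cell a L c ⊆ ball x ((n + 1) * (L / 2 ^ c.1)) := by
  intro y hy
  have hs : 0 < L / 2 ^ c.1 := by positivity
  rw [mem_ball]
  linarith [dist_le_of_mem_cell hL hy hx]

lemma cell_nonempty {a : Rn n} {L : ℝ} (hL : 0 < L) (c : ℕ × (Fin n → ℤ)) :
    (cell a L c).Nonempty := nonempty_of_measure_ne_zero (volume_cell_ne_zero hL c)

/-- Volume ratio of a ball of radius `(n + 1) s` to a cube of side `s`. -/
def ballRatio (n : ℕ) : ℝ≥0∞ := volume (ball (0 : Rn n) (n + 1))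

lemma ballRatio_ne_top : ballRatio n ≠ ⊤ := measure_ball_lt_top.ne

lemma volume_ball_mul (x : Rn n) {s : ℝ} (hs : 0 < s) (R : ℝ) :
    volume (ball x (R * s)) = volume (ball (0 : Rn n) R) * ENNReal.ofReal (s ^ n) := by
  have := Measure.addHaar_ball_mul_of_pos volume x hs R
  rw [finrank_euclideanSpace_fin] at this
  rw [mul_comm R s, this, mul_comm]

lemma volume_ball_cell {a : Rn n} {L : ℝ} (hL : 0 < L) (c : ℕ × (Fin n → ℤ)) (x : Rn n) :
    volume (ball x ((n + 1) * (L / 2 ^ c.1))) = ballRatio n * volume (cell a L c) := by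
  rw [volume_ball_mul x (by positivity), volume_cell hL, ballRatio]

lemma volume_cell_parent {a : Rn n} {L : ℝ} (hL : 0 < L) {c d : ℕ × (Fin n → ℤ)}
    (h : d.1 = c.1 + 1) : volume (cell a L c) = 2 ^ n * volume (cell a L d) := by
  rw [volume_cell hL, volume_cell hL, h, ← ENNReal.ofReal_ofNat 2, ← ENNReal.ofReal_pow (by simp),
    ← ENNReal.ofReal_mul (by positivity), ← mul_pow, pow_succ]
  congr 2
  field_simp

/-! ### Averages and bounded mean oscillation -/

lemma ofReal_abs_ballAvg_sub_mul_le {b : Rn n → ℝ} {Q : Set (Rn n)} (h0 : volume Q ≠ 0)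
    (ht : volume Q ≠ ⊤) (hb : IntegrableOn b Q) (c : ℝ) :
    ENNReal.ofReal |ballAvg b Q - c| * volume Q ≤ ∫⁻ y in Q, ENNReal.ofReal |b y - c| := by
  have hpos : 0 < (volume Q).toReal := ENNReal.toReal_pos h0 ht
  have hc : IntegrableOn (fun _ => c) Q := integrableOn_const ht
  have e : (ballAvg b Q - c) * (volume Q).toReal = ∫ y in Q, (b y - c) := by
    rw [integral_sub hb hc, setIntegral_const, ballAvg, sub_mul, div_mul_cancel₀ _ hpos.ne']
    simp [Measure.real, mul_comm]
  calc ENNReal.ofReal |ballAvg b Q - c| * volume Q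
      = ENNReal.ofReal |(ballAvg b Q - c) * (volume Q).toReal| := by
        rw [abs_mul, abs_of_pos hpos, ENNReal.ofReal_mul (abs_nonneg _), ENNReal.ofReal_toReal ht]
    _ = ‖∫ y in Q, (b y - c)‖ₑ := by rw [e, Real.enorm_eq_ofReal_abs]
    _ ≤ ∫⁻ y in Q, ‖b y - c‖ₑ := enorm_integral_le_lintegral_enorm _
    _ = _ := by simp only [Real.enorm_eq_ofReal_abs]

lemma ofReal_abs_sub_le (x y z : ℝ) :
    ENNReal.ofReal |x - z| ≤ ENNReal.ofReal |x - y| + ENNReal.ofReal |y - z| := by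
  rw [← ENNReal.ofReal_add (abs_nonneg _) (abs_nonneg _)]
  exact ENNReal.ofReal_le_ofReal (abs_sub_le x y z)

lemma lintegral_abs_sub_ballAvg_le {b : Rn n → ℝ} {Q : Set (Rn n)} (h0 : volume Q ≠ 0)
    (ht : volume Q ≠ ⊤) (hb : IntegrableOn b Q) (c : ℝ) :
    ∫⁻ y in Q, ENNReal.ofReal |b y - ballAvg b Q| ≤ 2 * ∫⁻ y in Q, ENNReal.ofReal |b y - c| := by
  calc ∫⁻ y in Q, ENNReal.ofReal |b y - ballAvg b Q|
      ≤ ∫⁻ y in Q, (ENNReal.ofReal |b y - c| + ENNReal.ofReal |ballAvg b Q - c|) :=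
        lintegral_mono fun y => by
          rw [abs_sub_comm (ballAvg b Q) c]; exact ofReal_abs_sub_le _ _ _
    _ = (∫⁻ y in Q, ENNReal.ofReal |b y - c|) + ENNReal.ofReal |ballAvg b Q - c| * volume Q := by
        rw [lintegral_add_right _ measurable_const, lintegral_const, Measure.restrict_apply_univ]
    _ ≤ _ := by
        rw [two_mul]
        exact add_le_add le_rfl (ofReal_abs_ballAvg_sub_mul_le h0 ht hb c)

lemma lintegral_ball_le_bmoNorm (b : Rn n → ℝ) (x : Rn n) {r : ℝ} (hr : 0 < r) :
    ∫⁻ y in ball x r, ENNReal.ofReal |b y - ballAvg b (ball x r)| ≤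
      bmoNorm b * volume (ball x r) := by
  have h : (volume (ball x r))⁻¹ * ∫⁻ y in ball x r, ENNReal.ofReal |b y - ballAvg b (ball x r)| ≤
      bmoNorm b := by
    unfold bmoNorm
    exact le_iSup_of_le x (le_iSup_of_le r (le_iSup_of_le hr le_rfl))
  rwa [mul_comm, ← div_eq_mul_inv, ENNReal.div_le_iff (measure_ball_pos _ _ hr).ne'
    measure_ball_lt_top.ne] at h

lemma integrableOn_of_subset_ball {b : Rn n → ℝ} (hb : LocallyIntegrable b) {Q : Set (Rn n)}
    {x : Rn n} {r : ℝ} (h : Q ⊆ ball x r) : IntegrableOn b Q :=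
  (hb.integrableOn_isCompact (isCompact_closedBall x r)).mono_set (h.trans ball_subset_closedBall)

lemma integrableOn_cell {b : Rn n → ℝ} (hb : LocallyIntegrable b) {a : Rn n} {L : ℝ} (hL : 0 < L)
    (c : ℕ × (Fin n → ℤ)) : IntegrableOn b (cell a L c) := by
  obtain ⟨x, hx⟩ := cell_nonempty (a := a) hL c
  exact integrableOn_of_subset_ball hb (cell_subset_ball hL hx)

lemma lintegral_cell_le_bmoNorm {b : Rn n → ℝ} (hb : LocallyIntegrable b) {a : Rn n} {L : ℝ}
    (hL : 0 < L) (c : ℕ × (Fin n → ℤ)) :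
    ∫⁻ y in cell a L c, ENNReal.ofReal |b y - ballAvg b (cell a L c)| ≤
      2 * ballRatio n * bmoNorm b * volume (cell a L c) := by
  obtain ⟨x, hx⟩ := cell_nonempty (a := a) hL c
  have hr : 0 < (n + 1) * (L / 2 ^ c.1) := by positivity
  calc _ ≤ 2 * ∫⁻ y in cell a L c,
        ENNReal.ofReal |b y - ballAvg b (ball x ((n + 1) * (L / 2 ^ c.1)))| :=
        lintegral_abs_sub_ballAvg_le (volume_cell_ne_zero hL c) (volume_cell_ne_top hL c)
          (integrableOn_cell hb hL c) _
    _ ≤ 2 * (bmoNorm b * volume (ball x ((n + 1) * (L / 2 ^ c.1)))) := by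
        gcongr
        exact (lintegral_mono_set (cell_subset_ball hL hx)).trans (lintegral_ball_le_bmoNorm b x hr)
    _ = _ := by rw [volume_ball_cell hL c x]; ring

/-! ### The Calderón–Zygmund decomposition of a cell -/

/-- Subcells of `c` on which the mean of `|b - b_c|` exceeds `2 A`. -/
def badCells (a : Rn n) (L : ℝ) (b : Rn n → ℝ) (A : ℝ≥0∞) (c : ℕ × (Fin n → ℤ)) :
    Set (ℕ × (Fin n → ℤ)) :=
  {d | c.1 ≤ d.1 ∧ cell a L d ⊆ cell a L c ∧
    2 * A * volume (cell a L d) <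
      ∫⁻ y in cell a L d, ENNReal.ofReal |b y - ballAvg b (cell a L c)|}

/-- The maximal elements of `badCells`. -/
def stopCells (a : Rn n) (L : ℝ) (b : Rn n → ℝ) (A : ℝ≥0∞) (c : ℕ × (Fin n → ℤ)) :
    Set (ℕ × (Fin n → ℤ)) :=
  {d | d ∈ badCells a L b A c ∧ ∀ e ∈ badCells a L b A c, cell a L d ⊆ cell a L e → d.1 ≤ e.1}

section Stopping

variable {a : Rn n} {L : ℝ} {b : Rn n → ℝ} {A : ℝ≥0∞} {c d : ℕ × (Fin n → ℤ)}

lemma cell_subset_of_mem_stopCells (hd : d ∈ stopCells a L b A c) : cell a L d ⊆ cell a L c :=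
  hd.1.2.1

lemma stopCells_pairwiseDisjoint : (stopCells a L b A c).PairwiseDisjoint (cell a L) := by
  have key : ∀ d ∈ stopCells a L b A c, ∀ e ∈ stopCells a L b A c, ∀ x ∈ cell a L d,
      x ∈ cell a L e → d.1 ≤ e.1 := by
    intro d hd e he x hxd hxe
    rcases le_total d.1 e.1 with h | h
    · exact h
    · exact hd.2 e he.1 (cell_subset_of_le h hxe hxd)
  intro d hd e he hne
  refine Set.disjoint_left.2 fun x hxd hxe => hne ?_
  have h := le_antisymm (key d hd e he x hxd hxe) (key e he d hd x hxe hxd)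
  rw [← cellAt_eq hxd, ← cellAt_eq hxe, h]

lemma exists_mem_stopCells {j : ℕ} {x : Rn n} (h : cellAt a L j x ∈ badCells a L b A c) :
    ∃ d ∈ stopCells a L b A c, x ∈ cell a L d := by
  classical
  have hex : ∃ i, cellAt a L i x ∈ badCells a L b A c := ⟨j, h⟩
  refine ⟨cellAt a L (Nat.find hex) x, ⟨Nat.find_spec hex, fun e he hsub => ?_⟩, rfl⟩
  have hxe : x ∈ cell a L e := hsub (mem_cellAt a L _ x)
  refine Nat.find_min' hex ?_
  rwa [cellAt_eq hxe]

lemma volume_biUnion_stopCells_le (hL : 0 < L) (hA0 : A ≠ 0) (hAt : A ≠ ⊤)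
    (hA : ∫⁻ y in cell a L c, ENNReal.ofReal |b y - ballAvg b (cell a L c)| ≤
      A * volume (cell a L c)) :
    volume (⋃ d ∈ stopCells a L b A c, cell a L d) ≤ volume (cell a L c) / 2 := by
  have hcount : (stopCells a L b A c).Countable := to_countable _
  have hsub : ⋃ d ∈ stopCells a L b A c, cell a L d ⊆ cell a L c :=
    iUnion₂_subset fun d hd => cell_subset_of_mem_stopCells hd
  have hInt : ∫⁻ y in ⋃ d ∈ stopCells a L b A c, cell a L d,
      ENNReal.ofReal |b y - ballAvg b (cell a L c)| = ∑' d : stopCells a L b A c,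
        ∫⁻ y in cell a L d.1, ENNReal.ofReal |b y - ballAvg b (cell a L c)| :=
    lintegral_biUnion hcount (fun d _ => measurableSet_cell hL d) stopCells_pairwiseDisjoint _
  have h1 : 2 * A * volume (⋃ d ∈ stopCells a L b A c, cell a L d) ≤ A * volume (cell a L c) := by
    rw [measure_biUnion hcount stopCells_pairwiseDisjoint fun d _ => measurableSet_cell hL d,
      ← ENNReal.tsum_mul_left]
    have hle : ∀ d : stopCells a L b A c, 2 * A * volume (cell a L d.1) ≤
        ∫⁻ y in cell a L d.1, ENNReal.ofReal |b y - ballAvg b (cell a L c)| :=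
      fun d => d.2.1.2.2.le
    refine (ENNReal.tsum_le_tsum hle).trans ?_
    rw [← hInt]
    exact (lintegral_mono_set hsub).trans hA
  rw [mul_comm 2 A, mul_assoc, ENNReal.mul_le_mul_iff_right hA0 hAt] at h1
  rw [ENNReal.le_div_iff_mul_le (by simp) (by simp), mul_comm]
  exact h1

lemma ofReal_abs_ballAvg_stopCells_sub_le (hL : 0 < L) (hA0 : A ≠ 0) (hAt : A ≠ ⊤)
    (hb : LocallyIntegrable b)
    (hA : ∫⁻ y in cell a L c, ENNReal.ofReal |b y - ballAvg b (cell a L c)| ≤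
      A * volume (cell a L c)) (hd : d ∈ stopCells a L b A c) :
    ENNReal.ofReal |ballAvg b (cell a L d) - ballAvg b (cell a L c)| ≤ 2 ^ (n + 1) * A := by
  obtain ⟨x, hx⟩ := cell_nonempty (a := a) hL d
  have hxc : x ∈ cell a L c := cell_subset_of_mem_stopCells hd hx
  have hlt : c.1 < d.1 := by
    refine lt_of_le_of_ne hd.1.1 fun h => ?_
    have hdc : d = c := by rw [← cellAt_eq hx, ← cellAt_eq hxc, h]
    have h1 := hd.1.2.2
    rw [hdc] at h1
    replace h1 := h1.trans_le hA
    rw [mul_comm 2 A, mul_assoc, ENNReal.mul_lt_mul_iff_right hA0 hAt, two_mul] at h1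
    exact absurd h1 (not_lt.2 le_self_add)
  set e := cellAt a L (d.1 - 1) x with he
  have hxe : x ∈ cell a L e := mem_cellAt _ _ _ _
  have he1 : d.1 = e.1 + 1 := by simp only [he, cellAt]; omega
  have hde : cell a L d ⊆ cell a L e := cell_subset_of_le (by omega) hxe hx
  have hec : cell a L e ⊆ cell a L c := cell_subset_of_le (by omega) hxc hxe
  have hnot : e ∉ badCells a L b A c := fun h => by
    have := hd.2 e h hde
    omega
  have hle : ∫⁻ y in cell a L e, ENNReal.ofReal |b y - ballAvg b (cell a L c)| ≤
      2 * A * volume (cell a L e) := by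
    by_contra hcon
    exact hnot ⟨by omega, hec, not_le.1 hcon⟩
  have h2 := (ofReal_abs_ballAvg_sub_mul_le (volume_cell_ne_zero hL d) (volume_cell_ne_top hL d)
    (integrableOn_cell hb hL d) (ballAvg b (cell a L c))).trans ((lintegral_mono_set hde).trans hle)
  rw [volume_cell_parent hL he1, ← mul_assoc, ENNReal.mul_le_mul_iff_left
    (volume_cell_ne_zero hL d) (volume_cell_ne_top hL d)] at h2
  calc _ ≤ _ := h2
    _ = _ := by ring

end Stopping

/-- Lebesgue differentiation along the cells of a dyadic grid. -/
lemma ae_ofReal_abs_sub_le_of_cells {a : Rn n} {L : ℝ} {b : Rn n → ℝ} (hL : 0 < L)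
    (hb : LocallyIntegrable b) :
    ∀ᵐ x : Rn n, ∀ (k : ℕ) (t : ℝ) (T : ℝ≥0∞),
      (∀ j, k ≤ j → ∫⁻ y in cell a L (cellAt a L j x), ENNReal.ofReal |b y - t| ≤
        T * volume (cell a L (cellAt a L j x))) → ENNReal.ofReal |b x - t| ≤ T := by
  filter_upwards [IsUnifLocDoublingMeasure.ae_tendsto_average_norm_sub volume hb 1]
    with x hx k t T hT
  have hpos : ∀ j : ℕ, 0 < (n + 1) * (L / 2 ^ j) := fun j => by positivity
  have hδ : Tendsto (fun j : ℕ => (n + 1) * (L / 2 ^ j)) atTop (𝓝[>] 0) := by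
    refine tendsto_nhdsWithin_iff.2 ⟨?_, Eventually.of_forall hpos⟩
    have : Tendsto (fun j : ℕ => (n + 1) * L * (1 / 2 : ℝ) ^ j) atTop (𝓝 ((n + 1) * L * 0)) :=
      (tendsto_pow_atTop_nhds_zero_of_lt_one (by norm_num) (by norm_num)).const_mul _
    rw [mul_zero] at this
    refine this.congr fun j => ?_
    rw [one_div, inv_pow]; ring
  have hlim := hx (fun _ : ℕ => x) (fun j : ℕ => (n + 1) * (L / 2 ^ j)) hδ
    (Eventually.of_forall fun j => mem_closedBall_self (by rw [one_mul]; exact (hpos j).le))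
  set g : ℕ → ℝ := fun j => ⨍ y in closedBall x ((n + 1) * (L / 2 ^ j)), ‖b y - b x‖ with hg
  set K : ℝ≥0∞ := ENNReal.ofReal ((n + 1) ^ n) * volume (ball (0 : Rn n) 1) with hK
  have hKt : K ≠ ⊤ := ENNReal.mul_ne_top ENNReal.ofReal_ne_top measure_ball_lt_top.ne
  have hlim2 : Tendsto (fun j => K * ENNReal.ofReal (g j) + T) atTop (𝓝 T) := by
    have h1 := ENNReal.tendsto_ofReal hlim
    rw [ENNReal.ofReal_zero] at h1
    have h2 := (ENNReal.Tendsto.const_mul h1 (Or.inr hKt)).add_const T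
    rwa [mul_zero, zero_add] at h2
  refine ge_of_tendsto hlim2 ?_
  filter_upwards [eventually_ge_atTop k] with j hj
  set c := cellAt a L j x with hc
  set B := closedBall x ((n + 1) * (L / 2 ^ j)) with hB
  have hsub : cell a L c ⊆ B :=
    (cell_subset_ball hL (mem_cellAt a L j x)).trans ball_subset_closedBall
  have hvB : volume B = K * volume (cell a L c) := by
    rw [hB, Measure.addHaar_closedBall _ _ (hpos j).le, finrank_euclideanSpace_fin, volume_cell hL,
      mul_pow, ENNReal.ofReal_mul (by positivity), hK]
    simp only [hc, cellAt]
    ring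
  have hBt : volume B ≠ ⊤ := measure_closedBall_lt_top.ne
  have hB0 : volume B ≠ 0 := (measure_closedBall_pos _ _ (hpos j)).ne'
  have hInt : IntegrableOn (fun y => ‖b y - b x‖) B :=
    ((hb.integrableOn_isCompact (isCompact_closedBall _ _)).sub (integrableOn_const hBt)).norm
  have hgB : ∫⁻ y in B, ENNReal.ofReal |b y - b x| = ENNReal.ofReal (g j) * volume B := by
    have hgj : g j = (volume B).toReal⁻¹ * ∫ y in B, ‖b y - b x‖ := by
      simp only [hg, setAverage_eq, smul_eq_mul, Measure.real, hB]
    have h1 := ofReal_integral_eq_lintegral_ofReal hInt (ae_of_all _ fun y => norm_nonneg _)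
    simp only [Real.norm_eq_abs] at h1 hgj
    rw [← h1, hgj, ENNReal.ofReal_mul (by positivity),
      ENNReal.ofReal_inv_of_pos (ENNReal.toReal_pos hB0 hBt), ENNReal.ofReal_toReal hBt, mul_assoc,
      mul_comm, mul_assoc, ENNReal.mul_inv_cancel hB0 hBt, mul_one]
  have hmain : ENNReal.ofReal |b x - t| * volume (cell a L c) ≤
      (K * ENNReal.ofReal (g j) + T) * volume (cell a L c) := by
    calc ENNReal.ofReal |b x - t| * volume (cell a L c)
        = ∫⁻ y in cell a L c, ENNReal.ofReal |b x - t| := by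
          rw [lintegral_const, Measure.restrict_apply_univ]
      _ ≤ ∫⁻ y in cell a L c, (ENNReal.ofReal |b y - b x| + ENNReal.ofReal |b y - t|) :=
          lintegral_mono fun y => by
            rw [abs_sub_comm (b y) (b x)]; exact ofReal_abs_sub_le _ _ _
      _ = (∫⁻ y in cell a L c, ENNReal.ofReal |b y - b x|) +
          ∫⁻ y in cell a L c, ENNReal.ofReal |b y - t| :=
          lintegral_add_left' ((hInt.mono_set hsub).aemeasurable.ennreal_ofReal) _
      _ ≤ ENNReal.ofReal (g j) * volume B + T * volume (cell a L c) :=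
          add_le_add ((lintegral_mono_set hsub).trans hgB.le) (hT j hj)
      _ = _ := by rw [hvB]; ring
  exact (ENNReal.mul_le_mul_iff_left (volume_cell_ne_zero hL c) (volume_cell_ne_top hL c)).1 hmain

lemma ae_ofReal_abs_sub_ballAvg_le_of_notMem_stopCells {a : Rn n} {L : ℝ} {b : Rn n → ℝ}
    (hL : 0 < L) (hb : LocallyIntegrable b) (A : ℝ≥0∞) :
    ∀ᵐ x : Rn n, ∀ c : ℕ × (Fin n → ℤ), x ∈ cell a L c →
      (∀ d ∈ stopCells a L b A c, x ∉ cell a L d) →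
      ENNReal.ofReal |b x - ballAvg b (cell a L c)| ≤ 2 * A := by
  filter_upwards [ae_ofReal_abs_sub_le_of_cells (a := a) hL hb] with x hx c hxc hnot
  refine hx c.1 _ _ fun j hj => ?_
  by_contra hcon
  obtain ⟨d, hd, hxd⟩ := exists_mem_stopCells (a := a) (L := L) (b := b) (A := A) (c := c)
    (j := j) (x := x) ⟨hj, cell_subset_of_le hj hxc (mem_cellAt a L j x), not_le.1 hcon⟩
  exact hnot d hd hxd

/-! ### Oscillation of a log-Hölder exponent on cells -/

/-- An integrable reference weight `κ (1 + |x|)^{-(n+1)}`. -/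
def refWeight (κ : ℝ) (x : Rn n) : ℝ≥0∞ := ENNReal.ofReal (κ * (1 + ‖x‖) ^ (-(n + 1 : ℝ)))

lemma exists_refWeight_lintegral_le (n : ℕ) :
    ∃ κ : ℝ, 0 < κ ∧ ∫⁻ x : Rn n, refWeight κ x ≤ 1 / 2 := by
  have hfin : ∫⁻ x : Rn n, ENNReal.ofReal ((1 + ‖x‖) ^ (-(n + 1 : ℝ))) < ⊤ :=
    finite_integral_one_add_norm (by rw [finrank_euclideanSpace_fin]; linarith)
  set I := ∫⁻ x : Rn n, ENNReal.ofReal ((1 + ‖x‖) ^ (-(n + 1 : ℝ))) with hI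
  have hpos : 0 < 2 * (1 + I.toReal) := by positivity
  refine ⟨(2 * (1 + I.toReal))⁻¹, inv_pos.2 hpos, ?_⟩
  have e : ∀ x : Rn n, refWeight (2 * (1 + I.toReal))⁻¹ x =
      ENNReal.ofReal (2 * (1 + I.toReal))⁻¹ * ENNReal.ofReal ((1 + ‖x‖) ^ (-(n + 1 : ℝ))) :=
    fun x => ENNReal.ofReal_mul (inv_pos.2 hpos).le
  simp only [e]
  have hmul : ENNReal.ofReal (2 * (1 + I.toReal))⁻¹ * I =
      ENNReal.ofReal ((2 * (1 + I.toReal))⁻¹ * I.toReal) := by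
    rw [ENNReal.ofReal_mul (inv_pos.2 hpos).le, ENNReal.ofReal_toReal hfin.ne]
  rw [lintegral_const_mul' _ _ ENNReal.ofReal_ne_top, ← hI, hmul]
  have : (1 / 2 : ℝ≥0∞) = ENNReal.ofReal (1 / 2) := by
    rw [ENNReal.ofReal_div_of_pos (by norm_num)]; simp
  rw [this]
  refine ENNReal.ofReal_le_ofReal ?_
  rw [inv_mul_le_iff₀ hpos]
  linarith

lemma exists_generation_side_le_one {L : ℝ} (k : ℕ) :
    ∃ j, k ≤ j ∧ L / 2 ^ j ≤ 1 ∧ (j = k ∨ 1 / 2 < L / 2 ^ j) := by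
  classical
  have hex : ∃ j, k ≤ j ∧ L / 2 ^ j ≤ 1 := by
    obtain ⟨i, hi⟩ := pow_unbounded_of_one_lt L (one_lt_two (α := ℝ))
    refine ⟨max i k, le_max_right _ _, ?_⟩
    rw [div_le_one (by positivity)]
    exact hi.le.trans (pow_le_pow_right₀ one_le_two (le_max_left _ _))
  refine ⟨Nat.find hex, (Nat.find_spec hex).1, (Nat.find_spec hex).2, ?_⟩
  by_contra! hcon
  obtain ⟨h1, h2⟩ := hcon
  have hk := (Nat.find_spec hex).1
  obtain ⟨i, hi⟩ : ∃ i, Nat.find hex = i + 1 := ⟨Nat.find hex - 1, by omega⟩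
  refine Nat.find_min hex (m := i) (by omega) ⟨by omega, ?_⟩
  rw [hi, pow_succ, ← div_div] at h2
  linarith

lemma le_setLIntegral_refWeight {κ : ℝ} (hκ : 0 < κ) {a : Rn n} {L : ℝ} (hL : 0 < L)
    {c : ℕ × (Fin n → ℤ)} {x : Rn n} (hx : x ∈ cell a L c) {j : ℕ} (hj : c.1 ≤ j)
    (hj1 : L / 2 ^ j ≤ 1) :
    ENNReal.ofReal (κ * ((n + 1) * (1 + ‖x‖)) ^ (-(n + 1 : ℝ)) * (L / 2 ^ j) ^ n) ≤
      ∫⁻ y in cell a L c, refWeight κ y := by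
  have hs : 0 < L / 2 ^ j := by positivity
  have hsub : cell a L (cellAt a L j x) ⊆ cell a L c :=
    cell_subset_of_le hj hx (mem_cellAt a L j x)
  refine le_trans ?_ (lintegral_mono_set hsub)
  rw [ENNReal.ofReal_mul (by positivity)]
  have hvol : volume (cell a L (cellAt a L j x)) = ENNReal.ofReal ((L / 2 ^ j) ^ n) :=
    volume_cell hL _
  rw [← hvol, ← setLIntegral_const]
  refine setLIntegral_mono' (measurableSet_cell hL _) fun y hy => ?_
  refine ENNReal.ofReal_le_ofReal (mul_le_mul_of_nonneg_left ?_ hκ.le)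
  have hd : dist y x ≤ n * (L / 2 ^ j) := dist_le_of_mem_cell hL hy (mem_cellAt a L j x)
  have hy' : ‖y‖ ≤ ‖x‖ + dist y x := by
    rw [dist_eq_norm]
    linarith [norm_le_norm_add_norm_sub' y x]
  have h1 : (n : ℝ) * (L / 2 ^ j) ≤ n := mul_le_of_le_one_right (by positivity) hj1
  refine Real.rpow_le_rpow_of_nonpos (by positivity) ?_ (by linarith [n.cast_nonneg (α := ℝ)])
  nlinarith [norm_nonneg x, n.cast_nonneg (α := ℝ),
    mul_nonneg (n.cast_nonneg (α := ℝ)) (norm_nonneg x)]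

lemma toReal_setLIntegral_refWeight {κ : ℝ} (hκ : 0 < κ) (hκ2 : ∫⁻ x : Rn n, refWeight κ x ≤ 1 / 2)
    {a : Rn n} {L : ℝ} (hL : 0 < L) (c : ℕ × (Fin n → ℤ)) :
    0 < (∫⁻ y in cell a L c, refWeight κ y).toReal ∧
      (∫⁻ y in cell a L c, refWeight κ y).toReal ≤ 1 / 2 := by
  have hle : ∫⁻ y in cell a L c, refWeight κ y ≤ 1 / 2 := (setLIntegral_le_lintegral _ _).trans hκ2
  obtain ⟨x, hx⟩ := cell_nonempty (a := a) hL c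
  obtain ⟨j, hj, hj1, -⟩ := exists_generation_side_le_one (L := L) c.1
  constructor
  · refine ENNReal.toReal_pos ?_ (ne_top_of_le_ne_top (by simp) hle)
    refine (lt_of_lt_of_le ?_ (le_setLIntegral_refWeight hκ hL hx hj hj1)).ne'
    rw [ENNReal.ofReal_pos]
    positivity
  · have := ENNReal.toReal_mono (by simp) hle
    simpa using this

/-- A log-Hölder exponent oscillates on a cell by at most the reciprocal of the logarithm of the
reference mass of the cell. -/
lemma LogHolder.exists_osc_le {q : Rn n → ℝ} (hq : LogHolder q) {M : ℝ} (hM : ∀ x, 1 < q x ∧ q x ≤ M)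
    {κ : ℝ} (hκ : 0 < κ) (hκ2 : ∫⁻ x : Rn n, refWeight κ x ≤ 1 / 2) :
    ∃ K : ℝ, 0 ≤ K ∧ ∀ (a : Rn n) (L : ℝ), 0 < L → ∀ c : ℕ × (Fin n → ℤ),
      ∀ x ∈ cell a L c, ∀ y ∈ cell a L c,
        |q x - q y| * (-Real.log (∫⁻ z in cell a L c, refWeight κ z).toReal) ≤ K := by
  obtain ⟨⟨C₀, hC₀⟩, ⟨C₁, hC₁⟩⟩ := hq
  have hM0 : 0 ≤ M := by linarith [(hM 0).1, (hM 0).2]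
  have hn1 : 0 ≤ Real.log (n + 1) := Real.log_nonneg (by linarith [n.cast_nonneg (α := ℝ)])
  have hl2 : 0 ≤ Real.log 2 := Real.log_nonneg one_le_two
  set K : ℝ := M * |Real.log κ| + (n + 1) * (M * Real.log (n + 1)) + (n + 1) * |C₁| +
    n * (M * Real.log (n + 1) + |C₀| + M * Real.log 2) with hK
  refine ⟨K, by positivity, fun a L hL c => ?_⟩
  have main : ∀ x ∈ cell a L c, ∀ y ∈ cell a L c, ‖x‖ ≤ ‖y‖ →
      |q x - q y| * (-Real.log (∫⁻ z in cell a L c, refWeight κ z).toReal) ≤ K := by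
    intro x hx y hy hxy
    obtain ⟨j, hj, hj1, hj2⟩ := exists_generation_side_le_one (L := L) c.1
    set τ := L / 2 ^ j with hτ
    have hτ0 : 0 < τ := by positivity
    have hx0 : 0 < 1 + ‖x‖ := by positivity
    obtain ⟨hH0, hH1⟩ := toReal_setLIntegral_refWeight hκ hκ2 (a := a) hL c
    have hHt : ∫⁻ z in cell a L c, refWeight κ z ≠ ⊤ := fun h => by simp [h] at hH0
    have hlow := ENNReal.toReal_mono hHt (le_setLIntegral_refWeight hκ hL hx hj hj1)
    rw [ENNReal.toReal_ofReal (by positivity)] at hlow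
    have hlog : -Real.log (∫⁻ z in cell a L c, refWeight κ z).toReal ≤
        |Real.log κ| + (n + 1) * Real.log (n + 1) + (n + 1) * Real.log (1 + ‖x‖) -
          n * Real.log τ := by
      have h1 := Real.log_le_log (by positivity) hlow
      rw [Real.log_mul (by positivity) (by positivity), Real.log_mul (by positivity) (by positivity),
        Real.log_rpow (by positivity), Real.log_mul (by positivity) (by positivity),
        Real.log_pow] at h1
      linarith [neg_abs_le (Real.log κ)]
    have hosc : |q x - q y| ≤ M := by
      rw [abs_le]
      constructor <;> linarith [(hM x).1, (hM x).2, (hM y).1, (hM y).2]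
    have hosc0 := abs_nonneg (q x - q y)
    have hinf : |q x - q y| * Real.log (1 + ‖x‖) ≤ |C₁| := by
      have he : 1 + ‖x‖ ≤ Real.exp 1 + ‖x‖ := by linarith [Real.add_one_le_exp (1 : ℝ)]
      have hl : Real.log (1 + ‖x‖) ≤ Real.log (Real.exp 1 + ‖x‖) := Real.log_le_log hx0 he
      have hp : 0 < Real.log (Real.exp 1 + ‖x‖) :=
        Real.log_pos (by linarith [Real.add_one_le_exp (1 : ℝ), norm_nonneg x])
      have h1 := hC₁ x y hxy
      rw [le_div_iff₀ hp] at h1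
      calc _ ≤ |q x - q y| * Real.log (Real.exp 1 + ‖x‖) := by gcongr
        _ ≤ C₁ := h1
        _ ≤ |C₁| := le_abs_self _
    have hloc : |q x - q y| * (-Real.log τ) ≤ M * Real.log (n + 1) + |C₀| + M * Real.log 2 := by
      rcases hj2 with rfl | hj2
      · rcases eq_or_ne x y with rfl | hne
        · simp only [sub_self, abs_zero, zero_mul]; positivity
        · have hD : 0 < dist x y := dist_pos.2 hne
          have hD1 : dist x y ≤ n * τ := dist_le_of_mem_cell hL hx hy
          have hτlog : -Real.log τ ≤ Real.log (n + 1) - Real.log (dist x y) := by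
            have h1 : dist x y ≤ (n + 1) * τ := by linarith
            have h2 := Real.log_le_log hD h1
            rw [Real.log_mul (by positivity) hτ0.ne'] at h2
            linarith
          have hDlog : |q x - q y| * (-Real.log (dist x y)) ≤ |C₀| + M * Real.log 2 := by
            rcases le_or_gt (dist x y) (1 / 2) with h | h
            · have hp : 0 < -Real.log (dist x y) := neg_pos.2 (Real.log_neg hD (by linarith))
              have h1 := hC₀ x y hD h
              rw [le_div_iff₀ hp] at h1
              have : 0 ≤ M * Real.log 2 := by positivity
              linarith [le_abs_self C₀]
            · have h1 : -Real.log (dist x y) ≤ Real.log 2 := by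
                have := Real.log_le_log (by norm_num) h.le
                rw [one_div, Real.log_inv] at this
                linarith
              have h2 : |q x - q y| * (-Real.log (dist x y)) ≤ M * Real.log 2 :=
                (mul_le_mul_of_nonneg_left h1 hosc0).trans (mul_le_mul_of_nonneg_right hosc hl2)
              linarith [abs_nonneg C₀]
          calc _ ≤ |q x - q y| * (Real.log (n + 1) - Real.log (dist x y)) := by gcongr
            _ = |q x - q y| * Real.log (n + 1) + |q x - q y| * (-Real.log (dist x y)) := by ring
            _ ≤ M * Real.log (n + 1) + (|C₀| + M * Real.log 2) := by gcongr
            _ = _ := by ring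
      · have h1 : -Real.log τ ≤ Real.log 2 := by
          have := Real.log_le_log (by norm_num) hj2.le
          rw [one_div, Real.log_inv] at this
          linarith
        have h2 : |q x - q y| * (-Real.log τ) ≤ M * Real.log 2 :=
          (mul_le_mul_of_nonneg_left h1 hosc0).trans (mul_le_mul_of_nonneg_right hosc hl2)
        have : 0 ≤ M * Real.log (n + 1) := by positivity
        linarith [abs_nonneg C₀]
    calc _ ≤ |q x - q y| * (|Real.log κ| + (n + 1) * Real.log (n + 1) +
          (n + 1) * Real.log (1 + ‖x‖) - n * Real.log τ) := by gcongr
      _ = |q x - q y| * |Real.log κ| + (n + 1) * (|q x - q y| * Real.log (n + 1)) +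
          (n + 1) * (|q x - q y| * Real.log (1 + ‖x‖)) + n * (|q x - q y| * (-Real.log τ)) := by
          ring
      _ ≤ K := by rw [hK]; gcongr
  intro x hx y hy
  rcases le_total ‖x‖ ‖y‖ with h | h
  · exact main x hx y hy h
  · rw [abs_sub_comm]; exact main y hy x hx h

/-! ### Weighted modulars of large subsets of cells -/

lemma rpow_modular_mul_le_luxNormOn {q v : Rn n → ℝ} (hq : ∀ x, 0 < q x) {Q B : Set (Rn n)}
    (hQ : MeasurableSet Q) (hB : MeasurableSet B) (hQB : Q ⊆ B) {lam : ℝ≥0∞} (h0 : lam ≠ 0)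
    (ht : lam ≠ ⊤) {p : ℝ} (hp : 0 < p) (hpq : ∀ x ∈ Q, p ≤ q x)
    (h1 : ∫⁻ x in Q, (ENNReal.ofReal |v x| / lam) ^ q x ≤ 1) :
    (∫⁻ x in Q, (ENNReal.ofReal |v x| / lam) ^ q x) ^ p⁻¹ * lam ≤ luxNormOn q B v := by
  refine le_luxNormOn hq hB fun mu hmu0 hmu => ?_
  rcases eq_or_ne mu ⊤ with rfl | hmt
  · exact le_top
  rcases le_total lam mu with h | h
  · refine le_trans ?_ h
    exact mul_le_of_le_one_left' (ENNReal.rpow_le_one h1 (inv_pos.2 hp).le)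
  have hθ1 : mu / lam ≤ 1 := ENNReal.div_le_of_le_mul (by rwa [one_mul])
  have hθt : mu / lam ≠ ⊤ := ne_top_of_le_ne_top ENNReal.one_ne_top hθ1
  have key : ∫⁻ x in Q, (ENNReal.ofReal |v x| / lam) ^ q x ≤ (mu / lam) ^ p := by
    calc ∫⁻ x in Q, (ENNReal.ofReal |v x| / lam) ^ q x
        ≤ ∫⁻ x in Q, (mu / lam) ^ p * (ENNReal.ofReal |v x| / mu) ^ q x := by
          refine setLIntegral_mono' hQ fun x hx => ?_
          have e : ENNReal.ofReal |v x| / lam = mu / lam * (ENNReal.ofReal |v x| / mu) := by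
            rw [div_eq_mul_inv, div_eq_mul_inv, div_eq_mul_inv, mul_mul_mul_comm, mul_comm lam⁻¹,
              ← mul_assoc, mul_comm mu, mul_assoc (ENNReal.ofReal _),
              ENNReal.mul_inv_cancel hmu0 hmt, mul_one]
          rw [e, ENNReal.mul_rpow_of_nonneg _ _ (hq x).le]
          gcongr ?_ * _
          exact ENNReal.rpow_le_rpow_of_exponent_ge hθ1 (hpq x hx)
      _ = (mu / lam) ^ p * ∫⁻ x in Q, (ENNReal.ofReal |v x| / mu) ^ q x :=
          lintegral_const_mul' _ _ (ENNReal.rpow_ne_top_of_nonneg hp.le hθt)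
      _ ≤ (mu / lam) ^ p * 1 := by
          gcongr
          exact (lintegral_mono_set hQB).trans hmu
      _ = _ := mul_one _
  calc _ ≤ ((mu / lam) ^ p) ^ p⁻¹ * lam := by gcongr
    _ = mu / lam * lam := by rw [ENNReal.rpow_rpow_inv hp.ne']
    _ = mu := ENNReal.div_mul_cancel h0 ht

lemma modular_rpow_mul_le_one {q v : Rn n → ℝ} (hq : ∀ x, 0 < q x) {F : Set (Rn n)}
    (hF : MeasurableSet F) {lam : ℝ≥0∞} {p : ℝ} (hp : 0 < p) (hpq : ∀ x ∈ F, q x ≤ p)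
    {τ : ℝ≥0∞} (hτ0 : τ ≠ 0) (hτ1 : τ ≤ 1)
    (h1 : ∫⁻ x in F, (ENNReal.ofReal |v x| / lam) ^ q x ≤ τ) :
    ∫⁻ x in F, (ENNReal.ofReal |v x| / (τ ^ p⁻¹ * lam)) ^ q x ≤ 1 := by
  have hτt : τ ≠ ⊤ := ne_top_of_le_ne_top ENNReal.one_ne_top hτ1
  set θ := τ ^ p⁻¹ with hθ
  have hθ1 : θ ≤ 1 := ENNReal.rpow_le_one hτ1 (inv_pos.2 hp).le
  have hθ0 : θ ≠ 0 := (ENNReal.rpow_pos (pos_iff_ne_zero.2 hτ0) hτt).ne'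
  have hθt : θ ≠ ⊤ := ne_top_of_le_ne_top ENNReal.one_ne_top hθ1
  calc ∫⁻ x in F, (ENNReal.ofReal |v x| / (θ * lam)) ^ q x
      ≤ ∫⁻ x in F, τ⁻¹ * (ENNReal.ofReal |v x| / lam) ^ q x := by
        refine setLIntegral_mono' hF fun x hx => ?_
        have e : ENNReal.ofReal |v x| / (θ * lam) = θ⁻¹ * (ENNReal.ofReal |v x| / lam) := by
          rw [div_eq_mul_inv, div_eq_mul_inv, ENNReal.mul_inv (Or.inl hθ0) (Or.inl hθt)]
          ring
        rw [e, ENNReal.mul_rpow_of_nonneg _ _ (hq x).le]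
        gcongr ?_ * _
        calc θ⁻¹ ^ q x ≤ θ⁻¹ ^ p :=
              ENNReal.rpow_le_rpow_of_exponent_le (ENNReal.one_le_inv.2 hθ1) (hpq x hx)
          _ = τ⁻¹ := by rw [ENNReal.inv_rpow, hθ, ENNReal.rpow_inv_rpow hp.ne']
    _ = τ⁻¹ * ∫⁻ x in F, (ENNReal.ofReal |v x| / lam) ^ q x :=
        lintegral_const_mul' _ _ (ENNReal.inv_ne_top.2 hτ0)
    _ ≤ τ⁻¹ * τ := by gcongr
    _ = 1 := ENNReal.inv_mul_cancel hτ0 hτt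

/-- On a cell whose modular dominates its reference mass, a subset of at least half the measure
carries a fixed proportion of the modular. -/
lemma IsAvar.exists_mul_modular_le {q : Rn n → ℝ} {M : ℝ} (hM : ∀ x, 1 < q x ∧ q x ≤ M)
    (hqm : Measurable q) (hqL : LogHolder q) {v : Rn n → ℝ} (hvm : AEMeasurable v)
    (hv : ∀ᵐ x : Rn n, 0 < v x) (hvA : IsAvar q v)
    {κ : ℝ} (hκ : 0 < κ) (hκ2 : ∫⁻ x : Rn n, refWeight κ x ≤ 1 / 2) :
    ∃ δ : ℝ≥0∞, δ ≠ 0 ∧ δ ≤ 1 ∧ ∀ (a : Rn n) (L : ℝ), 0 < L → ∀ (c : ℕ × (Fin n → ℤ))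
      (lam : ℝ≥0∞), lam ≠ 0 → lam ≠ ⊤ → ∀ F : Set (Rn n), MeasurableSet F → F ⊆ cell a L c →
      volume (cell a L c) / 2 ≤ volume F →
      ∫⁻ x in cell a L c, (ENNReal.ofReal |v x| / lam) ^ q x ≤ 1 →
      ∫⁻ x in cell a L c, refWeight κ x ≤
        ∫⁻ x in cell a L c, (ENNReal.ofReal |v x| / lam) ^ q x →
      δ * ∫⁻ x in cell a L c, (ENNReal.ofReal |v x| / lam) ^ q x ≤
        ∫⁻ x in F, (ENNReal.ofReal |v x| / lam) ^ q x := by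
  obtain ⟨C, hC⟩ := hvA
  obtain ⟨K, hK0, hK⟩ := hqL.exists_osc_le hM hκ hκ2
  have hq0 : ∀ x, 0 < q x := fun x => by linarith [(hM x).1]
  have hl2 : 0 < Real.log 2 := Real.log_pos one_lt_two
  set D : ℝ≥0∞ := 4 * C * ballRatio n + 1 with hD
  have hDt : D ≠ ⊤ := by
    have := ballRatio_ne_top (n := n)
    simp only [hD]; finiteness
  have hD1 : 1 ≤ D := le_add_self
  set P : ℝ := M + K / Real.log 2 with hP
  have hP0 : 0 < P := by
    have : 0 < M := by linarith [(hM 0).1, (hM 0).2]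
    positivity
  have hDP1 : 1 ≤ D ^ P := ENNReal.one_le_rpow hD1 hP0
  have hDP0 : D ^ P ≠ 0 := (zero_lt_one.trans_le hDP1).ne'
  have hDPt : D ^ P ≠ ⊤ := ENNReal.rpow_ne_top_of_nonneg hP0.le hDt
  have he1 : ENNReal.ofReal (Real.exp (-2 * K)) ≤ 1 := by
    rw [ENNReal.ofReal_le_one, Real.exp_le_one_iff]; linarith
  refine ⟨ENNReal.ofReal (Real.exp (-2 * K)) / D ^ P, ?_, ?_, ?_⟩
  · exact (ENNReal.div_pos (by simpa using Real.exp_pos _) hDPt).ne'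
  · exact ENNReal.div_le_of_le_mul (by rw [one_mul]; exact he1.trans hDP1)
  intro a L hL c lam h0 ht F hFm hFc hvol hW1 hHW
  set s := ∫⁻ x in cell a L c, (ENNReal.ofReal |v x| / lam) ^ q x with hs
  obtain ⟨hH0, hH1⟩ := toReal_setLIntegral_refWeight hκ hκ2 (a := a) hL c
  set h := (∫⁻ x in cell a L c, refWeight κ x).toReal with hh
  have hHt : ∫⁻ z in cell a L c, refWeight κ z ≠ ⊤ := fun h' => by simp [hh, h'] at hH0
  have hHof : ∫⁻ x in cell a L c, refWeight κ x = ENNReal.ofReal h :=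
    (ENNReal.ofReal_toReal hHt).symm
  have hlog : Real.log 2 ≤ -Real.log h := by
    have := Real.log_le_log hH0 hH1
    rw [one_div, Real.log_inv] at this
    linarith
  have hlog0 : 0 < -Real.log h := hl2.trans_le hlog
  set ω := K / (-Real.log h) with hω
  have hω0 : 0 ≤ ω := by positivity
  obtain ⟨x, hx⟩ := cell_nonempty (a := a) hL c
  have hosc : ∀ y ∈ cell a L c, |q x - q y| ≤ ω := fun y hy => by
    rw [hω, le_div_iff₀ hlog0]; exact hK a L hL c x hx y hy
  set qm := max 1 (q x - ω) with hqm'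
  set qp := q x + ω with hqp'
  have hqm1 : 1 ≤ qm := le_max_left _ _
  have hqm0 : 0 < qm := by linarith
  have hqp0 : 0 < qp := by linarith [hq0 x]
  have hqmle : ∀ y ∈ cell a L c, qm ≤ q y := fun y hy =>
    max_le (hM y).1.le (by linarith [(abs_le.1 (hosc y hy)).2])
  have hqple : ∀ y ∈ cell a L c, q y ≤ qp := fun y hy => by
    linarith [(abs_le.1 (hosc y hy)).1]
  have hqpP : qp ≤ P := by
    have : ω ≤ K / Real.log 2 := by rw [hω]; gcongr
    linarith [(hM x).2]
  set R := (n + 1) * (L / 2 ^ c.1) with hR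
  have hR0 : 0 < R := by positivity
  have hcB : cell a L c ⊆ ball x R := cell_subset_ball hL hx
  have hlow : s ^ qm⁻¹ * lam ≤ luxNormOn q (ball x R) v :=
    rpow_modular_mul_le_luxNormOn hq0 (measurableSet_cell hL c) measurableSet_ball hcB h0 ht
      hqm0 hqmle hW1
  have hs1 : s ≤ 1 := hW1
  have hst : s ≠ ⊤ := ne_top_of_le_ne_top ENNReal.one_ne_top hs1
  have hs0 : s ≠ 0 := by
    refine (lt_of_lt_of_le ?_ hHW).ne'
    rw [hHof]; exact ENNReal.ofReal_pos.2 hH0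
  have hslow : ENNReal.ofReal (Real.exp (-2 * K)) * s ≤ s ^ (qp / qm) := by
    have hexp : qp / qm ≤ 2 * ω + 1 := by
      rw [div_le_iff₀ hqm0]
      have : q x - ω ≤ qm := le_max_right _ _
      nlinarith
    have e : ENNReal.ofReal (Real.exp (-2 * K)) = ENNReal.ofReal h ^ (2 * ω) := by
      rw [ENNReal.ofReal_rpow_of_pos hH0, Real.rpow_def_of_pos hH0]
      congr 2
      have := hlog0.ne'
      rw [hω, ← mul_div_assoc, ← mul_div_assoc, eq_div_iff this]
      ring
    calc _ = ENNReal.ofReal h ^ (2 * ω) * s := by rw [e]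
      _ ≤ s ^ (2 * ω) * s := by
          gcongr
          rwa [← hHof]
      _ = s ^ (2 * ω + 1) := by
          rw [ENNReal.rpow_add _ _ hs0 hst, ENNReal.rpow_one]
      _ ≤ s ^ (qp / qm) := ENNReal.rpow_le_rpow_of_exponent_ge hs1 hexp
  refine le_of_forall_gt_imp_ge_of_dense fun τ hτ => ?_
  rw [ENNReal.mul_comm_div, ← mul_div_assoc]
  refine ENNReal.div_le_of_le_mul ?_
  rcases le_or_gt τ 1 with hτ1 | hτ1
  swap
  · calc _ ≤ (1 : ℝ≥0∞) * 1 := mul_le_mul' he1 hs1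
      _ ≤ τ * D ^ P := mul_le_mul' hτ1.le hDP1
  have hτ0 : τ ≠ 0 := (pos_of_gt hτ).ne'
  have hτt : τ ≠ ⊤ := ne_top_of_le_ne_top ENNReal.one_ne_top hτ1
  have hθ0 : τ ^ qp⁻¹ ≠ 0 := (ENNReal.rpow_pos (pos_iff_ne_zero.2 hτ0) hτt).ne'
  have hθt : τ ^ qp⁻¹ ≠ ⊤ := ENNReal.rpow_ne_top_of_nonneg (inv_pos.2 hqp0).le hτt
  have hmodF : ∫⁻ x in F, (ENNReal.ofReal |v x| / (τ ^ qp⁻¹ * lam)) ^ q x ≤ 1 :=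
    modular_rpow_mul_le_one hq0 hFm hqp0 (fun y hy => hqple y (hFc hy)) hτ0 hτ1 hτ.le
  have hA := IsAvar.volume_mul_luxNormOn_le (fun x => (hM x).1) hqm hvm hv hC x hR0
    (hFc.trans hcB) (mul_ne_zero hθ0 h0) (ENNReal.mul_ne_top hθt ht) hmodF
  have hvB : volume (ball x R) = ballRatio n * volume (cell a L c) := volume_ball_cell hL c x
  rw [hvB] at hA
  have hc0 : volume (cell a L c) ≠ 0 := volume_cell_ne_zero hL c
  have hct : volume (cell a L c) ≠ ⊤ := volume_cell_ne_top hL c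
  have hbase : s ^ qm⁻¹ ≤ D * τ ^ qp⁻¹ := by
    have h1 : volume (cell a L c) / 2 * (s ^ qm⁻¹ * lam) ≤
        2 * C * (τ ^ qp⁻¹ * lam) * (ballRatio n * volume (cell a L c)) :=
      (mul_le_mul' hvol hlow).trans hA
    have h2 : s ^ qm⁻¹ * (volume (cell a L c) * lam) ≤
        (4 * C * ballRatio n * τ ^ qp⁻¹) * (volume (cell a L c) * lam) := by
      calc s ^ qm⁻¹ * (volume (cell a L c) * lam)
          = 2 * (volume (cell a L c) / 2 * (s ^ qm⁻¹ * lam)) := by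
            rw [← mul_assoc 2, ENNReal.mul_div_cancel two_ne_zero ENNReal.ofNat_ne_top]; ring
        _ ≤ 2 * (2 * C * (τ ^ qp⁻¹ * lam) * (ballRatio n * volume (cell a L c))) := by gcongr
        _ = _ := by ring
    have h3 : s ^ qm⁻¹ ≤ 4 * C * ballRatio n * τ ^ qp⁻¹ :=
      (ENNReal.mul_le_mul_iff_left (mul_ne_zero hc0 h0) (ENNReal.mul_ne_top hct ht)).1 h2
    exact h3.trans (mul_le_mul_left le_self_add _)
  calc _ ≤ s ^ (qp / qm) := hslow
    _ = (s ^ qm⁻¹) ^ qp := by rw [← ENNReal.rpow_mul]; congr 1; field_simp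
    _ ≤ (D * τ ^ qp⁻¹) ^ qp := by gcongr
    _ = D ^ qp * τ := by
        rw [ENNReal.mul_rpow_of_nonneg _ _ hqp0.le, ENNReal.rpow_inv_rpow hqp0.ne']
    _ ≤ D ^ P * τ := by
        gcongr ?_ * _
        exact ENNReal.rpow_le_rpow_of_exponent_le hD1 hqpP
    _ = τ * D ^ P := mul_comm _ _

lemma add_half_le_one_of_add_mul_le {δ w e : ℝ≥0∞} (hδ : δ ≤ 1) (hw : w ≤ 1)
    (h : e + δ * w ≤ w + δ / 2) : e + δ / 2 ≤ 1 := by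
  have hδt : δ ≠ ⊤ := ne_top_of_le_ne_top ENNReal.one_ne_top hδ
  have hwt : w ≠ ⊤ := ne_top_of_le_ne_top ENNReal.one_ne_top hw
  have hd2 : δ / 2 ≠ ⊤ := ENNReal.div_ne_top hδt two_ne_zero
  have het : e ≠ ⊤ := ne_top_of_le_ne_top (ENNReal.add_ne_top.2 ⟨hwt, hd2⟩) (le_self_add.trans h)
  rw [← ENNReal.toReal_le_toReal (by finiteness) (by finiteness),
    ENNReal.toReal_add het (by finiteness), ENNReal.toReal_add hwt hd2, ENNReal.toReal_mul,
    ENNReal.toReal_div, ENNReal.toReal_ofNat] at h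
  rw [← ENNReal.toReal_le_toReal (by finiteness) (by finiteness),
    ENNReal.toReal_add het hd2, ENNReal.toReal_div, ENNReal.toReal_ofNat, ENNReal.toReal_one]
  have h1 : δ.toReal ≤ 1 := by simpa using ENNReal.toReal_mono ENNReal.one_ne_top hδ
  have h2 : w.toReal ≤ 1 := by simpa using ENNReal.toReal_mono ENNReal.one_ne_top hw
  nlinarith [mul_nonneg (sub_nonneg.2 h1) (sub_nonneg.2 h2)]

/-- Passing to a subset which meets each cell of a disjoint family in at most half of its measure
decreases the norm of the weight by a fixed factor. -/
lemma IsAvar.exists_contraction {q : Rn n → ℝ} {M : ℝ} (hM : ∀ x, 1 < q x ∧ q x ≤ M)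
    (hqm : Measurable q) (hqL : LogHolder q) {v : Rn n → ℝ} (hvm : AEMeasurable v)
    (hv : ∀ᵐ x : Rn n, 0 < v x) (hvA : IsAvar q v) :
    ∃ γ : ℝ≥0∞, γ ≠ 0 ∧ γ < 1 ∧ ∀ (a : Rn n) (L : ℝ), 0 < L → ∀ S : Set (ℕ × (Fin n → ℤ)),
      S.PairwiseDisjoint (cell a L) → ∀ E : Set (Rn n), MeasurableSet E →
      E ⊆ ⋃ c ∈ S, cell a L c →
      (∀ c ∈ S, volume (E ∩ cell a L c) ≤ volume (cell a L c) / 2) →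
      ∀ lam : ℝ≥0∞, lam ≠ 0 → lam ≠ ⊤ →
      ∫⁻ x in ⋃ c ∈ S, cell a L c, (ENNReal.ofReal |v x| / lam) ^ q x ≤ 1 →
      ∫⁻ x in E, (ENNReal.ofReal |v x| / (γ * lam)) ^ q x ≤ 1 := by
  obtain ⟨κ, hκ, hκ2⟩ := exists_refWeight_lintegral_le n
  obtain ⟨δ, hδ0, hδ1, hδ⟩ := IsAvar.exists_mul_modular_le hM hqm hqL hvm hv hvA hκ hκ2
  have hM0 : 0 < M := by linarith [(hM 0).1, (hM 0).2]
  have hq0 : ∀ x, 0 < q x := fun x => by linarith [(hM x).1]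
  have hδt : δ ≠ ⊤ := ne_top_of_le_ne_top ENNReal.one_ne_top hδ1
  have hd0 : δ / 2 ≠ 0 := (ENNReal.half_pos hδ0).ne'
  have hd1 : δ / 2 < 1 := (ENNReal.half_lt_self hδ0 hδt).trans_le hδ1
  have hτ0 : 1 - δ / 2 ≠ 0 := (tsub_pos_iff_lt.2 hd1).ne'
  have hτ1 : 1 - δ / 2 < 1 := ENNReal.sub_lt_self ENNReal.one_ne_top one_ne_zero hd0
  refine ⟨(1 - δ / 2) ^ M⁻¹, (ENNReal.rpow_pos (pos_iff_ne_zero.2 hτ0) hτ1.ne_top).ne',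
    ENNReal.rpow_lt_one hτ1 (inv_pos.2 hM0), ?_⟩
  intro a L hL S hS E hEm hES hEc lam h0 ht hlam
  refine modular_rpow_mul_le_one hq0 hEm hM0 (fun x _ => (hM x).2) hτ0 hτ1.le ?_
  refine ENNReal.le_sub_of_add_le_right hd1.ne_top ?_
  set W : Set (Rn n) → ℝ≥0∞ := fun F => ∫⁻ x in F, (ENNReal.ofReal |v x| / lam) ^ q x with hW
  have hWS : W (⋃ c ∈ S, cell a L c) = ∑' c : S, W (cell a L c) :=
    lintegral_biUnion S.to_countable (fun c _ => measurableSet_cell hL c) hS _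
  have hHS : ∫⁻ x in ⋃ c ∈ S, cell a L c, refWeight κ x =
      ∑' c : S, ∫⁻ x in cell a L c, refWeight κ x :=
    lintegral_biUnion S.to_countable (fun c _ => measurableSet_cell hL c) hS _
  have hES' : E = ⋃ c ∈ S, E ∩ cell a L c := by
    rw [← inter_iUnion₂]; exact (inter_eq_self_of_subset_left hES).symm
  have hWE : W E = ∑' c : S, W (E ∩ cell a L c) := by
    conv_lhs => rw [hES']
    exact lintegral_biUnion S.to_countable (fun c _ => hEm.inter (measurableSet_cell hL c))
      (hS.mono fun c => inter_subset_right) _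
  have hcell : ∀ c : S, W (E ∩ cell a L c) + δ * W (cell a L c) ≤
      W (cell a L c) + δ * ∫⁻ x in cell a L c, refWeight κ x := by
    rintro ⟨c, hc⟩
    have hcm := measurableSet_cell (a := a) hL c
    have hsplit : W (cell a L c ∩ E) + W (cell a L c \ E) = W (cell a L c) :=
      lintegral_inter_add_sdiff _ _ hEm
    rcases le_total (W (cell a L c)) (∫⁻ x in cell a L c, refWeight κ x) with h | h
    · exact add_le_add (lintegral_mono_set inter_subset_right) (mul_le_mul_right h δ)
    · have hhalf : volume (cell a L c) / 2 ≤ volume (cell a L c \ E) := by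
        have h1 := measure_inter_add_sdiff (μ := volume) (cell a L c) hEm
        rw [inter_comm] at h1
        have h2 : volume (cell a L c) / 2 + volume (cell a L c) / 2 ≤
            volume (cell a L c) / 2 + volume (cell a L c \ E) := by
          rw [ENNReal.add_halves]
          nth_rewrite 1 [← h1]
          exact add_le_add_left (hEc c hc) _
        exact (ENNReal.add_le_add_iff_left
          (ENNReal.div_ne_top (volume_cell_ne_top hL c) two_ne_zero)).1 h2
      have h3 : δ * W (cell a L c) ≤ W (cell a L c \ E) :=
        hδ a L hL c lam h0 ht _ (hcm.diff hEm) sdiff_subset hhalf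
          ((lintegral_mono_set (subset_biUnion_of_mem (u := fun c => cell a L c) hc)).trans hlam) h
      calc W (E ∩ cell a L c) + δ * W (cell a L c)
          ≤ W (cell a L c ∩ E) + W (cell a L c \ E) := by rw [inter_comm]; gcongr
        _ = W (cell a L c) := hsplit
        _ ≤ _ := le_self_add
  have hsum := ENNReal.tsum_le_tsum hcell
  rw [ENNReal.tsum_add, ENNReal.tsum_add, ENNReal.tsum_mul_left, ENNReal.tsum_mul_left, ← hWE,
    ← hWS, ← hHS] at hsum
  refine add_half_le_one_of_add_mul_le hδ1 hlam (hsum.trans ?_)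
  gcongr
  calc δ * ∫⁻ x in ⋃ c ∈ S, cell a L c, refWeight κ x ≤ δ * (1 / 2) := by
        gcongr
        exact (setLIntegral_le_lintegral _ _).trans hκ2
    _ = δ / 2 := by rw [one_div, div_eq_mul_inv]

/-! ### Summation over layers -/

/-- Jensen's inequality for countable convex combinations. -/
lemma rpow_tsum_mul_le {w z : ℕ → ℝ≥0∞} {p : ℝ} (hp : 1 ≤ p) (hw : ∑' i, w i ≤ 1) :
    (∑' i, w i * z i) ^ p ≤ ∑' i, w i * z i ^ p := by
  have hp0 : 0 < p := by linarith
  have h : ∑' i, w i * z i ≤ (∑' i, w i * z i ^ p) ^ p⁻¹ := by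
    rw [ENNReal.tsum_eq_iSup_sum]
    refine iSup_le fun s => ?_
    calc ∑ i ∈ s, w i * z i ≤ (∑ i ∈ s, w i) ^ (1 - p⁻¹) * (∑ i ∈ s, w i * z i ^ p) ^ p⁻¹ :=
          ENNReal.inner_le_weight_mul_Lp_of_nonneg s hp w z
      _ ≤ 1 * (∑' i, w i * z i ^ p) ^ p⁻¹ := by
          gcongr
          · exact ENNReal.rpow_le_one ((ENNReal.sum_le_tsum s).trans hw)
              (sub_nonneg.2 (inv_le_one_of_one_le₀ hp))
          · exact ENNReal.sum_le_tsum s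
      _ = _ := one_mul _
  calc (∑' i, w i * z i) ^ p ≤ ((∑' i, w i * z i ^ p) ^ p⁻¹) ^ p := by gcongr
    _ = _ := ENNReal.rpow_inv_rpow hp0.ne' _

/-- If the norm of `v` decays geometrically along the layers `Ω i`, then multiplying `v` by a
function controlled by the number of layers costs only a constant. -/
lemma luxNormOn_mul_le_of_layers {q : Rn n → ℝ} (hq : ∀ x, 1 < q x) (hqm : Measurable q)
    {v : Rn n → ℝ} (hvm : AEMeasurable v) {Q : Set (Rn n)} (hQ : MeasurableSet Q)
    {Ω : ℕ → Set (Rn n)} (hΩ : ∀ i, MeasurableSet (Ω i)) {γ : ℝ≥0∞} (hγ0 : γ ≠ 0) (hγ1 : γ < 1)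
    {lam : ℝ≥0∞} (h0 : lam ≠ 0) (ht : lam ≠ ⊤)
    (hmod : ∀ i, ∫⁻ x in Ω i, (ENNReal.ofReal |v x| / (γ ^ i * lam)) ^ q x ≤ 1)
    {h : Rn n → ℝ} {Λ : ℝ≥0∞} (hΛ0 : Λ ≠ 0)
    (hh : ∀ᵐ x, x ∈ Q → ENNReal.ofReal |h x| ≤ Λ * ∑' i, (Ω i).indicator 1 x) :
    luxNormOn q Q (fun x => v x * h x) ≤ Λ * (1 - γ)⁻¹ * lam := by
  have hq0 : ∀ x, 0 < q x := fun x => by linarith [hq x]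
  have hg0 : 1 - γ ≠ 0 := (tsub_pos_iff_lt.2 hγ1).ne'
  have hgt : 1 - γ ≠ ⊤ := ENNReal.sub_ne_top ENNReal.one_ne_top
  have hγi0 : ∀ i, γ ^ i ≠ 0 := fun i => pow_ne_zero i hγ0
  have hγit : ∀ i, γ ^ i ≠ ⊤ := fun i => ENNReal.pow_ne_top hγ1.ne_top
  have hw : ∑' i, (1 - γ) * γ ^ i = 1 := by
    rw [ENNReal.tsum_mul_left, ENNReal.tsum_geometric, ENNReal.mul_inv_cancel hg0 hgt]
  refine luxNormOn_le hq0 hQ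
    (mul_ne_zero (mul_ne_zero hΛ0 (ENNReal.inv_ne_zero.2 hgt)) h0) ?_
  set z : ℕ → Rn n → ℝ≥0∞ := fun i =>
    (Ω i).indicator fun x => ENNReal.ofReal |v x| / (γ ^ i * lam) with hz
  have hzm : ∀ i, AEMeasurable (z i) := fun i =>
    (hvm.abs.ennreal_ofReal.div_const _).indicator (hΩ i)
  have hpt : ∀ᵐ x ∂(volume.restrict Q),
      (ENNReal.ofReal |v x * h x| / (Λ * (1 - γ)⁻¹ * lam)) ^ q x ≤
        ∑' i, (1 - γ) * γ ^ i * z i x ^ q x := by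
    rw [ae_restrict_iff' hQ]
    filter_upwards [hh] with x hx hxQ
    refine le_trans ?_ (rpow_tsum_mul_le (hq x).le hw.le)
    refine ENNReal.rpow_le_rpow ?_ (hq0 x).le
    have e : ∀ i, (1 - γ) * γ ^ i * z i x =
        (1 - γ) * (ENNReal.ofReal |v x| / lam) * (Ω i).indicator 1 x := by
      intro i
      by_cases hxi : x ∈ Ω i
      · simp only [hz, indicator_of_mem hxi, Pi.one_apply, mul_one]
        rw [div_eq_mul_inv, div_eq_mul_inv, ENNReal.mul_inv (Or.inl (hγi0 i)) (Or.inl (hγit i))]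
        calc _ = (1 - γ) * (ENNReal.ofReal |v x| * lam⁻¹) * (γ ^ i * (γ ^ i)⁻¹) := by ring
          _ = _ := by rw [ENNReal.mul_inv_cancel (hγi0 i) (hγit i), mul_one]
      · simp [hz, hxi]
    simp only [e]
    rw [ENNReal.tsum_mul_left, abs_mul, ENNReal.ofReal_mul (abs_nonneg _)]
    refine ENNReal.div_le_of_le_mul ?_
    calc ENNReal.ofReal |v x| * ENNReal.ofReal |h x|
        ≤ ENNReal.ofReal |v x| * (Λ * ∑' i, (Ω i).indicator 1 x) := by
          gcongr; exact hx hxQ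
      _ = ((1 - γ) * (1 - γ)⁻¹) * (lam * lam⁻¹) *
          (ENNReal.ofReal |v x| * (Λ * ∑' i, (Ω i).indicator 1 x)) := by
          rw [ENNReal.mul_inv_cancel hg0 hgt, ENNReal.mul_inv_cancel h0 ht, one_mul, one_mul]
      _ = _ := by rw [div_eq_mul_inv]; ring
  refine (lintegral_mono_ae hpt).trans ?_
  have hzq : ∀ i, AEMeasurable (fun x => (1 - γ) * γ ^ i * z i x ^ q x) (volume.restrict Q) :=
    fun i => ((hzm i).restrict.pow hqm.aemeasurable).const_mul _
  rw [lintegral_tsum hzq]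
  calc ∑' i, ∫⁻ x in Q, (1 - γ) * γ ^ i * z i x ^ q x ≤ ∑' i, (1 - γ) * γ ^ i := by
        refine ENNReal.tsum_le_tsum fun i => ?_
        rw [lintegral_const_mul' _ _ (ENNReal.mul_ne_top hgt (hγit i))]
        refine mul_le_of_le_one_right' ((setLIntegral_le_lintegral _ _).trans ?_)
        have e : (fun x => z i x ^ q x) =
            (Ω i).indicator fun x => (ENNReal.ofReal |v x| / (γ ^ i * lam)) ^ q x := by
          funext x
          by_cases hxi : x ∈ Ω i
          · simp [hz, hxi]
          · simp [hz, hxi, hq0 x]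
        rw [e, lintegral_indicator (hΩ i)]
        exact hmod i
    _ = 1 := hw

/-! ### Iterated stopping cells -/

/-- The stopping cells of the `i`-th generation below `c`. -/
def stopGen (a : Rn n) (L : ℝ) (b : Rn n → ℝ) (A : ℝ≥0∞) (c : ℕ × (Fin n → ℤ)) :
    ℕ → Set (ℕ × (Fin n → ℤ))
  | 0 => {c}
  | i + 1 => ⋃ d ∈ stopGen a L b A c i, stopCells a L b A d

/-- The region covered by the `i`-th generation of stopping cells. -/
def stopLayer (a : Rn n) (L : ℝ) (b : Rn n → ℝ) (A : ℝ≥0∞) (c : ℕ × (Fin n → ℤ)) (i : ℕ) :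
    Set (Rn n) :=
  ⋃ d ∈ stopGen a L b A c i, cell a L d

section Generations

variable {a : Rn n} {L : ℝ} {b : Rn n → ℝ} {A : ℝ≥0∞} {c : ℕ × (Fin n → ℤ)}

lemma mem_stopGen_succ {i : ℕ} {e : ℕ × (Fin n → ℤ)} :
    e ∈ stopGen a L b A c (i + 1) ↔ ∃ d ∈ stopGen a L b A c i, e ∈ stopCells a L b A d := by
  simp [stopGen]

lemma mem_stopLayer {i : ℕ} {x : Rn n} :
    x ∈ stopLayer a L b A c i ↔ ∃ d ∈ stopGen a L b A c i, x ∈ cell a L d := by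
  simp [stopLayer]

lemma stopLayer_zero : stopLayer a L b A c 0 = cell a L c := by
  simp [stopLayer, stopGen]

lemma measurableSet_stopLayer (hL : 0 < L) (i : ℕ) : MeasurableSet (stopLayer a L b A c i) :=
  MeasurableSet.biUnion (to_countable _) fun d _ => measurableSet_cell hL d

lemma stopLayer_succ_subset (i : ℕ) : stopLayer a L b A c (i + 1) ⊆ stopLayer a L b A c i := by
  intro x hx
  obtain ⟨e, he, hxe⟩ := mem_stopLayer.1 hx
  obtain ⟨d, hd, hed⟩ := mem_stopGen_succ.1 he
  exact mem_stopLayer.2 ⟨d, hd, cell_subset_of_mem_stopCells hed hxe⟩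

lemma stopGen_pairwiseDisjoint (i : ℕ) :
    (stopGen a L b A c i).PairwiseDisjoint (cell a L) := by
  induction i with
  | zero => exact pairwiseDisjoint_singleton _ _
  | succ i ih =>
    intro e₁ he₁ e₂ he₂ hne
    obtain ⟨d₁, hd₁, h₁⟩ := mem_stopGen_succ.1 he₁
    obtain ⟨d₂, hd₂, h₂⟩ := mem_stopGen_succ.1 he₂
    rcases eq_or_ne d₁ d₂ with rfl | hd
    · exact stopCells_pairwiseDisjoint h₁ h₂ hne
    · exact (ih hd₁ hd₂ hd).mono (cell_subset_of_mem_stopCells h₁) (cell_subset_of_mem_stopCells h₂)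

lemma volume_stopLayer_succ_inter_le (hL : 0 < L) (hA0 : A ≠ 0) (hAt : A ≠ ⊤)
    (hA : ∀ c, ∫⁻ y in cell a L c, ENNReal.ofReal |b y - ballAvg b (cell a L c)| ≤
      A * volume (cell a L c)) {i : ℕ} {d : ℕ × (Fin n → ℤ)} (hd : d ∈ stopGen a L b A c i) :
    volume (stopLayer a L b A c (i + 1) ∩ cell a L d) ≤ volume (cell a L d) / 2 := by
  refine le_trans (measure_mono ?_) (volume_biUnion_stopCells_le hL hA0 hAt (hA d))
  rintro x ⟨hx, hxd⟩
  obtain ⟨e, he, hxe⟩ := mem_stopLayer.1 hx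
  obtain ⟨d', hd', hed'⟩ := mem_stopGen_succ.1 he
  have : d' = d := (stopGen_pairwiseDisjoint i).elim_set hd' hd x
    (cell_subset_of_mem_stopCells hed' hxe) hxd
  exact mem_biUnion (this ▸ hed') hxe

lemma ofReal_abs_ballAvg_stopGen_sub_le (hL : 0 < L) (hA0 : A ≠ 0) (hAt : A ≠ ⊤)
    (hb : LocallyIntegrable b)
    (hA : ∀ c, ∫⁻ y in cell a L c, ENNReal.ofReal |b y - ballAvg b (cell a L c)| ≤
      A * volume (cell a L c)) (i : ℕ) :
    ∀ d ∈ stopGen a L b A c i,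
      ENNReal.ofReal |ballAvg b (cell a L d) - ballAvg b (cell a L c)| ≤ i * (2 ^ (n + 1) * A) := by
  induction i with
  | zero =>
    intro d hd
    rw [show d = c from hd]
    simp
  | succ i ih =>
    intro e he
    obtain ⟨d, hd, hed⟩ := mem_stopGen_succ.1 he
    calc _ ≤ _ := ofReal_abs_sub_le _ (ballAvg b (cell a L d)) _
      _ ≤ 2 ^ (n + 1) * A + i * (2 ^ (n + 1) * A) :=
          add_le_add (ofReal_abs_ballAvg_stopCells_sub_le hL hA0 hAt hb (hA d) hed) (ih d hd)
      _ = _ := by push_cast; ring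

/-- Pointwise control of the oscillation of `b` by the number of layers. -/
lemma ae_ofReal_abs_sub_ballAvg_le_tsum (hL : 0 < L) (hA0 : A ≠ 0) (hAt : A ≠ ⊤)
    (hb : LocallyIntegrable b)
    (hA : ∀ c, ∫⁻ y in cell a L c, ENNReal.ofReal |b y - ballAvg b (cell a L c)| ≤
      A * volume (cell a L c)) :
    ∀ᵐ x, x ∈ cell a L c → ENNReal.ofReal |b x - ballAvg b (cell a L c)| ≤
      2 ^ (n + 1) * A * ∑' i, (stopLayer a L b A c i).indicator 1 x := by
  classical
  filter_upwards [ae_ofReal_abs_sub_ballAvg_le_of_notMem_stopCells (a := a) hL hb A] with x hx hxc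
  by_cases hall : ∀ i, x ∈ stopLayer a L b A c i
  · have : ∑' i, (stopLayer a L b A c i).indicator (1 : Rn n → ℝ≥0∞) x = ⊤ := by
      simp only [indicator_of_mem (hall _), Pi.one_apply]
      exact ENNReal.tsum_const_eq_top_of_ne_zero one_ne_zero
    rw [this, ENNReal.mul_top (mul_ne_zero (pow_ne_zero _ two_ne_zero) hA0)]
    exact le_top
  push Not at hall
  have hmem : ∀ j < Nat.find hall, x ∈ stopLayer a L b A c j := fun j hj =>
    not_not.1 (Nat.find_min hall hj)
  obtain ⟨k, hk⟩ : ∃ k, Nat.find hall = k + 1 := by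
    refine Nat.exists_eq_succ_of_ne_zero fun h => ?_
    have := Nat.find_spec hall
    rw [h, stopLayer_zero] at this
    exact this hxc
  have hnot : x ∉ stopLayer a L b A c (k + 1) := hk ▸ Nat.find_spec hall
  obtain ⟨d, hd, hxd⟩ := mem_stopLayer.1 (hmem k (by omega))
  have h1 : ENNReal.ofReal |b x - ballAvg b (cell a L d)| ≤ 2 * A := hx d hxd fun e he hxe =>
    hnot (mem_stopLayer.2 ⟨e, mem_stopGen_succ.2 ⟨d, hd, he⟩, hxe⟩)
  have h2 := ofReal_abs_ballAvg_stopGen_sub_le hL hA0 hAt hb hA k d hd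
  have h3 : ((k + 1 : ℕ) : ℝ≥0∞) ≤ ∑' i, (stopLayer a L b A c i).indicator 1 x := by
    refine le_trans (le_of_eq ?_) (ENNReal.sum_le_tsum (Finset.range (k + 1)))
    rw [Finset.sum_congr rfl fun i hi => indicator_of_mem
      (hmem i (by rw [hk]; exact Finset.mem_range.1 hi)) (1 : Rn n → ℝ≥0∞)]
    simp
  calc _ ≤ _ := ofReal_abs_sub_le _ (ballAvg b (cell a L d)) _
    _ ≤ 2 * A + k * (2 ^ (n + 1) * A) := add_le_add h1 h2
    _ ≤ 2 ^ (n + 1) * A + k * (2 ^ (n + 1) * A) := by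
        gcongr
        exact le_self_pow₀ one_le_two (by omega)
    _ = 2 ^ (n + 1) * A * ((k + 1 : ℕ) : ℝ≥0∞) := by push_cast; ring
    _ ≤ _ := by gcongr

end Generations

/-! ### Averages over concentric balls -/

lemma volume_ball_mul_eq (x : Rn n) {ρ : ℝ} (hρ : 0 < ρ) (s : ℝ) :
    volume (ball x (ρ * s)) = ENNReal.ofReal (ρ ^ n) * volume (ball x s) := by
  rw [Measure.addHaar_ball_mul_of_pos volume x hρ s, finrank_euclideanSpace_fin,
    Measure.addHaar_ball_center volume x s]

lemma ofReal_abs_ballAvg_sub_ballAvg_ball_le {b : Rn n → ℝ} (hb : LocallyIntegrable b)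
    {Q : Set (Rn n)} (h0 : volume Q ≠ 0) (ht : volume Q ≠ ⊤) {x : Rn n} {R : ℝ} (hR : 0 < R)
    (hQ : Q ⊆ ball x R) {ρ : ℝ≥0∞} (hρ : volume (ball x R) ≤ ρ * volume Q) :
    ENNReal.ofReal |ballAvg b Q - ballAvg b (ball x R)| ≤ ρ * bmoNorm b := by
  have h1 : ENNReal.ofReal |ballAvg b Q - ballAvg b (ball x R)| * volume Q ≤
      ρ * bmoNorm b * volume Q :=
    calc _ ≤ ∫⁻ y in Q, ENNReal.ofReal |b y - ballAvg b (ball x R)| :=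
          ofReal_abs_ballAvg_sub_mul_le h0 ht (integrableOn_of_subset_ball hb hQ) _
      _ ≤ ∫⁻ y in ball x R, ENNReal.ofReal |b y - ballAvg b (ball x R)| := lintegral_mono_set hQ
      _ ≤ bmoNorm b * volume (ball x R) := lintegral_ball_le_bmoNorm b x hR
      _ ≤ bmoNorm b * (ρ * volume Q) := by gcongr
      _ = _ := by ring
  exact (ENNReal.mul_le_mul_iff_left h0 ht).1 h1

lemma ofReal_abs_ballAvg_two_pow_sub_le {b : Rn n → ℝ} (hb : LocallyIntegrable b) (x : Rn n)
    {r : ℝ} (hr : 0 < r) (J : ℕ) :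
    ENNReal.ofReal |ballAvg b (ball x (2 ^ J * r)) - ballAvg b (ball x r)| ≤
      J * (2 ^ n * bmoNorm b) := by
  induction J with
  | zero => simp
  | succ J ih =>
    have hs : 0 < 2 ^ J * r := by positivity
    have e : 2 ^ (J + 1) * r = 2 * (2 ^ J * r) := by ring
    have hvol : volume (ball x (2 ^ (J + 1) * r)) ≤ 2 ^ n * volume (ball x (2 ^ J * r)) := by
      rw [e, volume_ball_mul_eq x two_pos, ENNReal.ofReal_pow zero_le_two]
      simp
    have h1 := ofReal_abs_ballAvg_sub_ballAvg_ball_le hb (measure_ball_pos volume x hs).ne'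
      measure_ball_lt_top.ne (x := x) (R := 2 ^ (J + 1) * r) (by positivity)
      (ball_subset_ball (by rw [e]; linarith)) hvol
    rw [abs_sub_comm] at h1
    calc _ ≤ _ := ofReal_abs_sub_le _ (ballAvg b (ball x (2 ^ J * r))) _
      _ ≤ 2 ^ n * bmoNorm b + J * (2 ^ n * bmoNorm b) := add_le_add h1 ih
      _ = _ := by push_cast; ring

lemma exists_two_pow_mul_near {r R : ℝ} (hr : 0 < r) (hR : r ≤ R) :
    ∃ J : ℕ, R ≤ 2 ^ J * r ∧ 2 ^ J * r ≤ 2 * R ∧ (J : ℝ) ≤ 1 + 2 * Real.log (R / r) := by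
  obtain ⟨k, hk1, hk2⟩ := exists_nat_pow_near ((one_le_div hr).2 hR) one_lt_two
  refine ⟨k + 1, ?_, ?_, ?_⟩
  · exact ((div_lt_iff₀ hr).1 hk2).le
  · have := (le_div_iff₀ hr).1 hk1
    rw [pow_succ]; linarith
  · have h1 := Real.log_le_log (by positivity) hk1
    rw [Real.log_pow] at h1
    have h2 : (1 : ℝ) / 2 ≤ Real.log 2 := by linarith [Real.log_two_gt_d9]
    have h3 : (k : ℝ) * (1 / 2) ≤ k * Real.log 2 := by gcongr
    push_cast
    linarith

/-! ### Comparison of norms of the weight -/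

lemma luxNormOn_mono {p : Rn n → ℝ} (hp : ∀ x, 0 < p x) {E F : Set (Rn n)} (hE : MeasurableSet E)
    (hF : MeasurableSet F) (hEF : E ⊆ F) (f : Rn n → ℝ) : luxNormOn p E f ≤ luxNormOn p F f :=
  le_luxNormOn hp hF fun _ h0 h1 => luxNormOn_le hp hE h0 ((lintegral_mono_set hEF).trans h1)

lemma IsAvar.luxNormOn_ball_mul_le {q : Rn n → ℝ} (hq : ∀ x, 1 < q x) (hqm : Measurable q)
    {v : Rn n → ℝ} (hvm : AEMeasurable v) (hv : ∀ᵐ x : Rn n, 0 < v x) (hvA : IsAvar q v)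
    {ρ : ℝ} (hρ : 1 ≤ ρ) :
    ∃ D : ℝ≥0, ∀ (x : Rn n) (s : ℝ), 0 < s →
      luxNormOn q (ball x (ρ * s)) v ≤ D * luxNormOn q (ball x s) v := by
  obtain ⟨C, hC⟩ := hvA
  have hq0 : ∀ x, 0 < q x := fun x => by linarith [hq x]
  refine ⟨2 * C * Real.toNNReal (ρ ^ n) + 1, fun x s hs => ?_⟩
  set D : ℝ≥0 := 2 * C * Real.toNNReal (ρ ^ n) + 1 with hD
  have hD0 : (D : ℝ≥0∞) ≠ 0 := by simp [hD]
  rw [mul_comm (D : ℝ≥0∞), ← ENNReal.div_le_iff hD0 ENNReal.coe_ne_top]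
  refine le_luxNormOn hq0 measurableSet_ball fun lam h0 h1 => ?_
  rcases eq_or_ne lam ⊤ with rfl | ht
  · exact le_top
  have hB0 : volume (ball x s) ≠ 0 := (measure_ball_pos volume x hs).ne'
  have hBt : volume (ball x s) ≠ ⊤ := measure_ball_lt_top.ne
  have h2 := IsAvar.volume_mul_luxNormOn_le hq hqm hvm hv hC x (r := ρ * s) (by positivity)
    (ball_subset_ball (le_mul_of_one_le_left hs.le hρ)) h0 ht h1
  rw [volume_ball_mul_eq x (by positivity)] at h2
  have h3 : luxNormOn q (ball x (ρ * s)) v * volume (ball x s) ≤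
      2 * C * ENNReal.ofReal (ρ ^ n) * lam * volume (ball x s) := by
    calc _ = volume (ball x s) * luxNormOn q (ball x (ρ * s)) v := mul_comm _ _
      _ ≤ _ := h2
      _ = _ := by ring
  have h4 := (ENNReal.mul_le_mul_iff_left hB0 hBt).1 h3
  refine ENNReal.div_le_of_le_mul (h4.trans ?_)
  rw [mul_comm lam]
  gcongr
  rw [hD]
  push_cast
  exact le_self_add

/-! ### The cell circumscribing a ball -/

/-- The lower corner of the cube of side `2 * t` centred at `x₀`. -/
def cubeCorner (x₀ : Rn n) (t : ℝ) : Rn n := WithLp.toLp 2 fun i => x₀ i - t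

lemma ball_subset_cell (x₀ : Rn n) {t : ℝ} (ht : 0 < t) :
    ball x₀ t ⊆ cell (cubeCorner x₀ t) (2 * t) (0, 0) := by
  intro y hy
  rw [mem_cell_iff (by positivity)]
  intro i
  have h1 : |y i - x₀ i| < t := by
    have h2 : ‖(y - x₀) i‖ ≤ ‖y - x₀‖ := PiLp.norm_apply_le (y - x₀) i
    rw [mem_ball, dist_eq_norm] at hy
    exact lt_of_le_of_lt (by simpa using h2) hy
  rw [abs_lt] at h1
  simp only [cubeCorner, mem_Ico]
  constructor <;> simp <;> linarith [h1.1, h1.2]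

/-- The oscillation of a `BMO` function on a cell in a weighted variable exponent space. -/
lemma IsAvar.exists_luxNormOn_cell_le {q : Rn n → ℝ} {M : ℝ} (hM : ∀ x, 1 < q x ∧ q x ≤ M)
    (hqm : Measurable q) (hqL : LogHolder q) {v : Rn n → ℝ} (hvm : AEMeasurable v)
    (hv : ∀ᵐ x : Rn n, 0 < v x) (hvA : IsAvar q v) :
    ∃ K : ℝ≥0, ∀ (b : Rn n → ℝ), LocallyIntegrable b → ∀ (a : Rn n) (L : ℝ), 0 < L →
      ∀ (c : ℕ × (Fin n → ℤ)) (A : ℝ≥0∞), A ≠ 0 → A ≠ ⊤ →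
      (∀ c, ∫⁻ y in cell a L c, ENNReal.ofReal |b y - ballAvg b (cell a L c)| ≤
        A * volume (cell a L c)) → ∀ u : ℝ,
      luxNormOn q (cell a L c) (fun x => v x * (b x - u)) ≤
        K * (2 ^ (n + 1) * A + ENNReal.ofReal |ballAvg b (cell a L c) - u|) *
          luxNormOn q (cell a L c) v := by
  obtain ⟨γ, hγ0, hγ1, hγ⟩ := IsAvar.exists_contraction hM hqm hqL hvm hv hvA
  have hq0 : ∀ x, 0 < q x := fun x => by linarith [(hM x).1]
  have hg0 : 1 - γ ≠ 0 := (tsub_pos_iff_lt.2 hγ1).ne'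
  have hgt : 1 - γ ≠ ⊤ := ENNReal.sub_ne_top ENNReal.one_ne_top
  refine ⟨((1 - γ)⁻¹).toNNReal, fun b hb a L hL c A hA0 hAt hA u => ?_⟩
  rw [ENNReal.coe_toNNReal (ENNReal.inv_ne_top.2 hg0)]
  set Λ := 2 ^ (n + 1) * A + ENNReal.ofReal |ballAvg b (cell a L c) - u| with hΛ
  have hΛ0 : Λ ≠ 0 := by
    have : (2 : ℝ≥0∞) ^ (n + 1) * A ≠ 0 := mul_ne_zero (pow_ne_zero _ two_ne_zero) hA0
    simp only [hΛ, ne_eq, add_eq_zero, not_and]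
    exact fun h => absurd h this
  have hΛt : Λ ≠ ⊤ := by simp only [hΛ]; finiteness
  have hK0 : (1 - γ)⁻¹ * Λ ≠ 0 := mul_ne_zero (ENNReal.inv_ne_zero.2 hgt) hΛ0
  have hKt : (1 - γ)⁻¹ * Λ ≠ ⊤ := ENNReal.mul_ne_top (ENNReal.inv_ne_top.2 hg0) hΛt
  have hcm := measurableSet_cell (a := a) hL c
  rw [mul_comm, ← ENNReal.div_le_iff hK0 hKt]
  refine le_luxNormOn hq0 hcm fun lam h0 h1 => ?_
  rcases eq_or_ne lam ⊤ with rfl | ht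
  · exact le_top
  have hmod : ∀ i, ∫⁻ x in stopLayer a L b A c i,
      (ENNReal.ofReal |v x| / (γ ^ i * lam)) ^ q x ≤ 1 := by
    intro i
    induction i with
    | zero => simpa [stopLayer_zero] using h1
    | succ i ih =>
      have := hγ a L hL _ (stopGen_pairwiseDisjoint i) _ (measurableSet_stopLayer hL (i + 1))
        (stopLayer_succ_subset i)
        (fun d hd => volume_stopLayer_succ_inter_le hL hA0 hAt hA hd) (γ ^ i * lam)
        (mul_ne_zero (pow_ne_zero i hγ0) h0)
        (ENNReal.mul_ne_top (ENNReal.pow_ne_top hγ1.ne_top) ht) ih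
      rwa [← mul_assoc, ← pow_succ'] at this
  have hpt : ∀ᵐ x, x ∈ cell a L c → ENNReal.ofReal |b x - u| ≤
      Λ * ∑' i, (stopLayer a L b A c i).indicator 1 x := by
    filter_upwards [ae_ofReal_abs_sub_ballAvg_le_tsum (c := c) hL hA0 hAt hb hA] with x hx hxc
    have hone : (1 : ℝ≥0∞) ≤ ∑' i, (stopLayer a L b A c i).indicator 1 x := by
      refine le_trans (le_of_eq ?_) (ENNReal.le_tsum 0)
      rw [stopLayer_zero, indicator_of_mem hxc, Pi.one_apply]
    calc _ ≤ _ := ofReal_abs_sub_le _ (ballAvg b (cell a L c)) _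
      _ ≤ 2 ^ (n + 1) * A * ∑' i, (stopLayer a L b A c i).indicator 1 x +
          ENNReal.ofReal |ballAvg b (cell a L c) - u| *
            ∑' i, (stopLayer a L b A c i).indicator 1 x :=
          add_le_add (hx hxc) (le_mul_of_one_le_right' hone)
      _ = _ := by rw [hΛ, add_mul]
  have := luxNormOn_mul_le_of_layers (fun x => (hM x).1) hqm hvm hcm
    (fun i => measurableSet_stopLayer hL i) hγ0 hγ1 h0 ht hmod hΛ0 hpt
  refine ENNReal.div_le_of_le_mul (this.trans (le_of_eq ?_))
  ring

lemma ballRatio_ne_zero : ballRatio n ≠ 0 := by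
  intro h
  have := volume_ball_cell (a := (0 : Rn n)) one_pos (0, 0) 0
  rw [h, zero_mul] at this
  exact (measure_ball_pos volume _ (by positivity)).ne' this

lemma le_mul_of_forall_lt_le_mul {x k y : ℝ≥0∞} (hk : k ≠ ⊤) (hy : y ≠ ⊤)
    (h : ∀ z, y < z → z ≠ ⊤ → x ≤ k * z) : x ≤ k * y := by
  rcases eq_or_ne k 0 with rfl | hk0
  · simpa using h (y + 1) (ENNReal.lt_add_right hy one_ne_zero) (by finiteness)
  · rw [mul_comm, ← ENNReal.div_le_iff hk0 hk]
    refine le_of_forall_gt_imp_ge_of_dense fun z hz => ?_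
    rcases eq_or_ne z ⊤ with rfl | hzt
    · exact le_top
    · rw [ENNReal.div_le_iff hk0 hk, mul_comm]
      exact h z hz hzt

/-- The average of `b` over the circumscribed cube of `B(x₀, t)` differs from that over
`B(x₀, r)` by at most a multiple of `1 + log (t / r)`. -/
lemma exists_ofReal_abs_ballAvg_cell_sub_le (n : ℕ) :
    ∃ K : ℝ≥0, ∀ b : Rn n → ℝ, LocallyIntegrable b → ∀ (x₀ : Rn n) (r t : ℝ), 0 < r → r ≤ t →
      ENNReal.ofReal |ballAvg b (cell (cubeCorner x₀ t) (2 * t) (0, 0)) - ballAvg b (ball x₀ r)| ≤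
        K * ENNReal.ofReal (1 + Real.log (t / r)) * bmoNorm b := by
  set ρ : ℝ := 2 * (n + 1) with hρ
  have hρ2 : 2 ≤ ρ := by rw [hρ]; linarith [n.cast_nonneg (α := ℝ)]
  have hlρ : 0 ≤ Real.log ρ := Real.log_nonneg (by linarith)
  have hR : ballRatio n ≠ ⊤ := ballRatio_ne_top
  refine ⟨(2 ^ n * ballRatio n + ENNReal.ofReal (2 + 2 * Real.log ρ) * 2 ^ n).toNNReal,
    fun b hb x₀ r t hr hrt => ?_⟩
  rw [ENNReal.coe_toNNReal (by finiteness)]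
  have ht : 0 < t := hr.trans_le hrt
  have hL : 0 < 2 * t := by positivity
  have hlog : 0 ≤ Real.log (t / r) := Real.log_nonneg ((one_le_div hr).2 hrt)
  set Q := cell (cubeCorner x₀ t) (2 * t) (0, 0) with hQ
  have hx₀ : x₀ ∈ Q := ball_subset_cell x₀ ht (mem_ball_self ht)
  have hQB : Q ⊆ ball x₀ (ρ * t) := by
    have h1 : Q ⊆ ball x₀ ((n + 1) * (2 * t / 2 ^ 0)) := cell_subset_ball hL hx₀
    have e : (n + 1) * (2 * t / 2 ^ 0) = ρ * t := by rw [hρ]; ring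
    rwa [e] at h1
  have hvol : volume (ball x₀ (ρ * t)) = ballRatio n * volume Q := by
    have h1 : volume (ball x₀ ((n + 1) * (2 * t / 2 ^ 0))) = ballRatio n * volume Q :=
      volume_ball_cell hL (0, 0) x₀
    have e : (n + 1) * (2 * t / 2 ^ 0) = ρ * t := by rw [hρ]; ring
    rwa [e] at h1
  obtain ⟨J, hJ1, hJ2, hJ3⟩ := exists_two_pow_mul_near hr (R := ρ * t) (by nlinarith)
  have hvolJ : volume (ball x₀ (2 ^ J * r)) ≤ 2 ^ n * ballRatio n * volume Q := by
    calc volume (ball x₀ (2 ^ J * r)) ≤ volume (ball x₀ (2 * (ρ * t))) :=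
          measure_mono (ball_subset_ball hJ2)
      _ = 2 ^ n * ballRatio n * volume Q := by
          rw [volume_ball_mul_eq x₀ two_pos, hvol, ENNReal.ofReal_pow zero_le_two,
            ENNReal.ofReal_ofNat, mul_assoc]
  have h1 := ofReal_abs_ballAvg_sub_ballAvg_ball_le hb (volume_cell_ne_zero hL _)
    (volume_cell_ne_top hL _) (by positivity) (hQB.trans (ball_subset_ball hJ1)) hvolJ
  have h2 := ofReal_abs_ballAvg_two_pow_sub_le hb x₀ hr J
  have hJle : (J : ℝ≥0∞) ≤
      ENNReal.ofReal (2 + 2 * Real.log ρ) * ENNReal.ofReal (1 + Real.log (t / r)) := by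
    rw [← ENNReal.ofReal_mul (by positivity), ← ENNReal.ofReal_natCast]
    refine ENNReal.ofReal_le_ofReal (hJ3.trans ?_)
    rw [mul_div_assoc, Real.log_mul (by positivity) (by positivity)]
    nlinarith [mul_nonneg hlρ hlog]
  have hlog1 : 1 ≤ ENNReal.ofReal (1 + Real.log (t / r)) := by
    rw [ENNReal.one_le_ofReal]; linarith
  calc _ ≤ _ := ofReal_abs_sub_le _ (ballAvg b (ball x₀ (2 ^ J * r))) _
    _ ≤ 2 ^ n * ballRatio n * bmoNorm b + J * (2 ^ n * bmoNorm b) := add_le_add h1 h2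
    _ ≤ 2 ^ n * ballRatio n * bmoNorm b * ENNReal.ofReal (1 + Real.log (t / r)) +
        ENNReal.ofReal (2 + 2 * Real.log ρ) * ENNReal.ofReal (1 + Real.log (t / r)) *
          (2 ^ n * bmoNorm b) :=
        add_le_add (le_mul_of_one_le_right' hlog1) (mul_le_mul_left hJle _)
    _ = _ := by ring

/-- Lemma 2.8: for `q(·) ∈ LH ∩ 𝒫`, `v ∈ A_{q(·)}`, `b ∈ BMO`, `l > 1`
and `t/r ≥ l`,
`‖b - b_{B(x₀,r)}‖_{L^{q(·)}(B(x₀,t), v dx)} ≲ (1 + log(t/r)) ‖b‖_{BMO} ‖v‖_{L^{q(·)}(B(x₀,t))}`,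
with a constant independent of `b`, `x₀`, `r`, `t`. -/
theorem stmt10 {n : ℕ} (q : Rn n → ℝ) (hqP : MemP q) (hqLH : LogHolder q)
    (v : Rn n → ℝ) (hv : IsWeight v) (hvA : IsAvar q v)
    (l : ℝ) (hl : 1 < l) :
    ∃ C : ℝ≥0, ∀ b : Rn n → ℝ, MemBMO b →
      ∀ (x₀ : Rn n) (r t : ℝ), 0 < r → l ≤ t / r →
        luxNormOn q (ball x₀ t) (fun y => v y * (b y - ballAvg b (ball x₀ r))) ≤
          C * ENNReal.ofReal (1 + Real.log (t / r)) * bmoNorm b *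
            luxNormOn q (ball x₀ t) v := by
  obtain ⟨hqm, p, M, hp1, hpM⟩ := hqP
  have hM : ∀ x, 1 < q x ∧ q x ≤ M := fun x => ⟨hp1.trans_le (hpM x).1, (hpM x).2⟩
  have hq1 : ∀ x, 1 < q x := fun x => (hM x).1
  have hq0 : ∀ x, 0 < q x := fun x => zero_lt_one.trans (hq1 x)
  have hvm : AEMeasurable v := hv.1.aestronglyMeasurable.aemeasurable
  obtain ⟨K₁, hK₁⟩ := IsAvar.exists_luxNormOn_cell_le hM hqm hqLH hvm hv.2.2 hvA
  obtain ⟨K₂, hK₂⟩ := exists_ofReal_abs_ballAvg_cell_sub_le n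
  obtain ⟨D, hD⟩ := IsAvar.luxNormOn_ball_mul_le hq1 hqm hvm hv.2.2 hvA
    (ρ := 2 * ((n : ℝ) + 1)) (by nlinarith [(n.cast_nonneg : (0 : ℝ) ≤ n)])
  set R : ℝ≥0 := (ballRatio n).toNNReal with hR
  have hRc : (R : ℝ≥0∞) = ballRatio n := ENNReal.coe_toNNReal (ballRatio_ne_top)
  refine ⟨K₁ * (2 ^ (n + 2) * R + K₂) * D, fun b hb x₀ r t hr hlt => ?_⟩
  have hrt : r ≤ t := (one_le_div hr).1 (hl.le.trans hlt)
  have ht : 0 < t := hr.trans_le hrt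
  set Q := cell (cubeCorner x₀ t) (2 * t) (0, 0) with hQ
  set Lg := ENNReal.ofReal (1 + Real.log (t / r)) with hLg
  have hLg1 : 1 ≤ Lg := by
    rw [hLg, ENNReal.one_le_ofReal]
    linarith [Real.log_nonneg (hl.le.trans hlt)]
  have hBQ : ball x₀ t ⊆ Q := ball_subset_cell x₀ ht
  have hQm : MeasurableSet Q := measurableSet_cell (by positivity) _
  have hQB : Q ⊆ ball x₀ (2 * ((n : ℝ) + 1) * t) := by
    refine (cell_subset_ball (by positivity) (hBQ (mem_ball_self ht))).trans
      (ball_subset_ball (le_of_eq ?_))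
    norm_num
    ring
  have hvQ : luxNormOn q Q v ≤ D * luxNormOn q (ball x₀ t) v :=
    (luxNormOn_mono hq0 hQm measurableSet_ball hQB v).trans (hD x₀ t ht)
  have hvt : luxNormOn q (ball x₀ t) v ≠ ⊤ := by
    obtain ⟨C, hC⟩ := hvA
    exact (IsAvar.luxNormOn_lt_top hq1 hqm hvm hv.2.2 hC x₀ ht).ne
  have key : ∀ β : ℝ≥0∞, bmoNorm b < β → β ≠ ⊤ →
      luxNormOn q (ball x₀ t) (fun y => v y * (b y - ballAvg b (ball x₀ r))) ≤
        (K₁ * (2 ^ (n + 2) * R + K₂) * D * Lg * luxNormOn q (ball x₀ t) v) * β := by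
    intro β hβ hβt
    calc luxNormOn q (ball x₀ t) (fun y => v y * (b y - ballAvg b (ball x₀ r)))
        ≤ luxNormOn q Q (fun y => v y * (b y - ballAvg b (ball x₀ r))) :=
          luxNormOn_mono hq0 measurableSet_ball hQm hBQ _
      _ ≤ K₁ * (2 ^ (n + 1) * (2 * ballRatio n * β) +
            ENNReal.ofReal |ballAvg b Q - ballAvg b (ball x₀ r)|) * luxNormOn q Q v := by
          refine hK₁ b hb.1 (cubeCorner x₀ t) (2 * t) (by positivity) (0, 0) (2 * ballRatio n * β)
            ?_ ?_ (fun c => ?_) _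
          · exact mul_ne_zero (mul_ne_zero two_ne_zero (ballRatio_ne_zero))
              (bot_lt_of_lt hβ).ne'
          · exact ENNReal.mul_ne_top (ENNReal.mul_ne_top (by simp) (ballRatio_ne_top)) hβt
          · refine (lintegral_cell_le_bmoNorm hb.1 (by positivity) c).trans ?_
            gcongr
      _ ≤ K₁ * (2 ^ (n + 1) * (2 * ballRatio n * (Lg * β)) + K₂ * Lg * β) *
            (D * luxNormOn q (ball x₀ t) v) := by
          gcongr
          · exact le_mul_of_one_le_left zero_le hLg1
          · exact (hK₂ b hb.1 x₀ r t hr hrt).trans (by gcongr)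
      _ = _ := by
          rw [hRc]
          ring
  have hfin := le_mul_of_forall_lt_le_mul ?_ hb.2.ne key
  · refine hfin.trans (le_of_eq ?_)
    push_cast
    ring
  · exact ENNReal.mul_ne_top (ENNReal.mul_ne_top
      (by exact_mod_cast ENNReal.coe_ne_top (r := K₁ * (2 ^ (n + 2) * R + K₂) * D))
      ENNReal.ofReal_ne_top) hvt
end GWM
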